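/- For m ∈ O_K totally positive with K = ℚ(√5), O_K = ℤ[(1+√5)/2], the number of representations of m as a sum of four squares over O_K equals r_Q(m) = 8·Σ_{(0)≠(d)|(m)} N(d) − 4·Σ_{(2)|(d)|(m)} N(d) + 8·Σ_{(4)|(d)|(m)} N(d), where the sums run over nonzero principal ideals (d) dividing (m) (with the indicated divisibility by (2) and (4)) and N denotes the absolute norm. -/

import Mathlib

namespace FS5

/-- The ring `ℤ[(1+√5)/2]`. -/
abbrev O := QuadraticAlgebra ℤ 1 1

open QuadraticAlgebra

/-- real embedding attached to a root of `x^2 = x + 1`. -/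
noncomputable def emb (t : ℝ) (ht : t * t = t + 1) : O →+* ℝ where
  toFun x := x.re + x.im * t
  map_one' := by simp [QuadraticAlgebra.re_one, QuadraticAlgebra.im_one]
  map_zero' := by simp
  map_add' x y := by simp; ring
  map_mul' x y := by
    simp
    linear_combination (-(x.im : ℝ) * y.im) * ht

theorem gold : Real.goldenRatio * Real.goldenRatio = Real.goldenRatio + 1 := by
  have := Real.goldenRatio_sq; rw [← this]; ring
theorem goldc : Real.goldenConj * Real.goldenConj = Real.goldenConj + 1 := by
  have := Real.goldenConj_sq; rw [← this]; ring

noncomputable def e1 : O →+* ℝ := emb _ gold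
noncomputable def e2 : O →+* ℝ := emb _ goldc

theorem e1_apply (x : O) : e1 x = x.re + x.im * Real.goldenRatio := rfl
theorem e2_apply (x : O) : e2 x = x.re + x.im * Real.goldenConj := rfl

/-- norm to the integers -/
def nm (x : O) : ℤ := x.re ^ 2 + x.re * x.im - x.im ^ 2

theorem nm_mul (x y : O) : nm (x * y) = nm x * nm y := by
  simp [nm]; ring

theorem nm_one : nm 1 = 1 := by simp [nm, QuadraticAlgebra.re_one, QuadraticAlgebra.im_one]

theorem nm_eq (x : O) : (nm x : ℝ) = e1 x * e2 x := by
  have h1 := Real.goldenRatio_mul_goldenConj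
  have h2 := Real.goldenRatio_add_goldenConj
  rw [e1_apply, e2_apply]
  simp only [nm]; push_cast
  linear_combination (-(x.im:ℝ)^2) * h1 - (x.re * x.im : ℝ) * h2

theorem nm_eq_zero {x : O} : nm x = 0 ↔ x = 0 := by
  constructor
  · intro h
    have h5 : (2 * x.re + x.im) ^ 2 = 5 * x.im ^ 2 := by
      simp only [nm] at h; linear_combination 4 * h
    have him : x.im = 0 := by
      by_contra hne
      have hirr : Irrational (√(5:ℕ)) := Nat.Prime.irrational_sqrt (by norm_num)
      apply hirr
      refine ⟨|((2 * x.re + x.im : ℤ) : ℚ) / x.im|, ?_⟩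
      have : ((5:ℕ):ℝ) = (((2 * x.re + x.im : ℤ) : ℝ) / x.im)^2 := by
        have h5' : ((2 * x.re + x.im : ℤ) : ℝ) ^ 2 = 5 * (x.im:ℝ) ^ 2 := by exact_mod_cast h5
        have hne' : (x.im : ℝ) ≠ 0 := by exact_mod_cast hne
        field_simp; push_cast at h5' ⊢; linarith
      rw [this, Real.sqrt_sq_eq_abs]; push_cast; rfl
    have hre : x.re = 0 := by
      rw [him] at h5; nlinarith
    ext <;> simp [hre, him]
  · rintro rfl; simp [nm]

instance : NoZeroDivisors O where
  eq_zero_or_eq_zero_of_mul_eq_zero {a b} h := by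
    have := nm_mul a b
    rw [h, nm_eq_zero.2 rfl] at this
    rcases mul_eq_zero.1 this.symm with h | h
    · exact Or.inl (nm_eq_zero.1 h)
    · exact Or.inr (nm_eq_zero.1 h)

instance : IsDomain O := NoZeroDivisors.to_isDomain _

/-- totally positive -/
def TP (x : O) : Prop := 0 < e1 x ∧ 0 < e2 x

theorem TP.mul {x y : O} (hx : TP x) (hy : TP y) : TP (x * y) := by
  constructor <;> rw [map_mul]
  · exact mul_pos hx.1 hy.1
  · exact mul_pos hx.2 hy.2

theorem TP.of_mul {x y : O} (hx : TP x) (hy : TP (x * y)) : TP y := by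
  obtain ⟨h1, h2⟩ := hy
  rw [map_mul] at h1 h2
  exact ⟨(mul_pos_iff_of_pos_left hx.1).1 h1, (mul_pos_iff_of_pos_left hx.2).1 h2⟩

theorem TP.nm_pos {x : O} (hx : TP x) : 0 < nm x := by
  have := nm_eq x
  have h2 : (0:ℝ) < nm x := by rw [this]; exact mul_pos hx.1 hx.2
  exact_mod_cast h2

theorem TP.ne_zero {x : O} (hx : TP x) : x ≠ 0 := by
  rintro rfl; have := hx.1; simp at this

theorem TP.re_pos {x : O} (hx : TP x) : 0 < x.re := by
  have h := hx
  obtain ⟨h1, h2⟩ := hx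
  rw [e1_apply] at h1
  rw [e2_apply] at h2
  have g1 := Real.goldenRatio_pos
  have g2 := Real.goldenConj_neg
  have h3 : 0 < (x.re : ℝ) * (Real.goldenRatio - Real.goldenConj) := by
    nlinarith [mul_pos h1 (neg_pos.2 g2), mul_pos h2 g1]
  have : (0:ℝ) < x.re := by
    by_contra hc
    nlinarith
  exact_mod_cast this

theorem tp_of {x : O} (h1 : 0 < x.re) (h2 : 0 < nm x) : TP x := by
  have h3 : 0 < e1 x * e2 x := by rw [← nm_eq]; exact_mod_cast h2
  rcases mul_pos_iff.1 h3 with h | h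
  · exact h
  · exfalso
    have : TP (-x) := ⟨by rw [map_neg]; linarith [h.1], by rw [map_neg]; linarith [h.2]⟩
    have := this.re_pos
    simp at this; omega

theorem tp_iff {x : O} : TP x ↔ 0 < x.re ∧ 0 < nm x :=
  ⟨fun h => ⟨h.re_pos, h.nm_pos⟩, fun h => tp_of h.1 h.2⟩

/-- the golden ratio -/
def ph : O := ⟨0, 1⟩

theorem ph_unit : IsUnit ph := by
  refine IsUnit.of_mul_eq_one (⟨-1, 1⟩ : O) ?_
  decide

/-- every nonzero element is associated to a totally positive one -/
theorem exists_tp_assoc {x : O} (hx : x ≠ 0) : ∃ y, TP y ∧ Associated x y := by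
  have aux : ∀ z : O, 0 < nm z → ∃ y, TP y ∧ Associated z y := by
    intro z hz
    have hre : z.re ≠ 0 := by
      intro h; simp only [nm, h] at hz; nlinarith
    rcases lt_or_gt_of_ne hre with h | h
    · refine ⟨-z, tp_of (by simpa using h) (by simpa [nm] using hz), ?_⟩
      exact (Associated.refl z).neg_right
    · exact ⟨z, tp_of h hz, Associated.refl _⟩
  have hn : nm x ≠ 0 := fun h => hx (nm_eq_zero.1 h)
  rcases lt_or_gt_of_ne hn with h | h
  · obtain ⟨y, hy, hxy⟩ := aux (x * ph) (by
      rw [nm_mul]; have : nm ph = -1 := by decide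
      rw [this]; omega)
    refine ⟨y, hy, Associated.trans ?_ hxy⟩
    exact associated_mul_unit_right x ph ph_unit
  · exact aux x h

theorem nm_unit {x : O} (hx : IsUnit x) : nm x = 1 ∨ nm x = -1 := by
  obtain ⟨y, hy⟩ := hx.exists_right_inv
  have := nm_mul x y
  rw [hy, nm_one] at this
  exact Int.isUnit_iff.1 (IsUnit.of_mul_eq_one _ this.symm)

/-- totally positive units are squares -/
theorem tp_unit_sq_aux (n : ℕ) : ∀ x : O, 0 < x.re → nm x = 1 → x.re.natAbs + x.im.natAbs ≤ n →
    ∃ y : O, y ^ 2 = x := by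
  induction n with
  | zero => intro x h1 h2 h3; omega
  | succ n ih =>
    intro x h1 h2 h3
    obtain ⟨a, b⟩ := x
    simp only [nm] at *
    rcases lt_trichotomy b 0 with hb | hb | hb
    · have hab : 0 < a + b := by nlinarith
      have h4 : 0 ≤ a + 2 * b + a := by omega
      obtain ⟨y, hy⟩ := ih ⟨a + b, a + 2 * b⟩ hab (by simp only; linear_combination h2) (by
        simp only
        have : a + 2 * b ≤ 0 ∨ 0 < a + 2 * b := by omega
        rcases this with h | h
        · have : a + b + -(a + 2*b) < a + -b := by nlinarith
          omega
        · exfalso; nlinarith [mul_pos h hab, mul_pos h (neg_pos.2 hb)])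
      refine ⟨y * ⟨-1, 1⟩, ?_⟩
      rw [mul_pow, hy]
      ext <;> simp [sq] <;> ring
    · subst hb
      refine ⟨1, ?_⟩
      have : a = 1 := by nlinarith
      subst this
      decide
    · have hab : a ≤ b := by nlinarith
      have hab2 : b < 2 * a := by nlinarith
      obtain ⟨y, hy⟩ := ih ⟨2 * a - b, b - a⟩ (by simp only; omega)
        (by simp only; linear_combination h2) (by simp only; omega)
      refine ⟨y * ⟨0, 1⟩, ?_⟩
      rw [mul_pow, hy]
      ext <;> simp [sq] <;> ring

theorem tp_unit_sq {x : O} (hx : TP x) (hu : IsUnit x) : ∃ y : O, y ^ 2 = x := by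
  have h1 := hx.nm_pos
  refine tp_unit_sq_aux _ x hx.re_pos ?_ le_rfl
  rcases nm_unit hu with h | h <;> omega

/-- Euclidean division -/
theorem O_div (x y : O) (hy : y ≠ 0) : ∃ q : O, (nm (x - y * q)).natAbs < (nm y).natAbs := by
  have hn : nm y ≠ 0 := fun h => hy (nm_eq_zero.1 h)
  -- conjugate of y
  set yc : O := ⟨y.re + y.im, -y.im⟩ with hyc
  have hyy : y * yc = ⟨nm y, 0⟩ := by ext <;> simp [nm, hyc] <;> ring
  have hyyc : nm yc = nm y := by simp [nm, hyc]; ring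
  set c := x * yc with hc
  set D := nm y with hD
  have round : ∀ a : ℤ, ∃ q : ℤ, 2 * |a - D * q| ≤ |D| := by
    intro a
    have hD0 : 0 < |D| := abs_pos.2 hn
    refine ⟨D.sign * ((2 * a + |D|) / (2 * |D|)), ?_⟩
    have h1 : D * (D.sign * ((2 * a + |D|) / (2 * |D|))) = |D| * ((2 * a + |D|) / (2 * |D|)) := by
      rw [← mul_assoc, Int.mul_sign_self, ← Int.abs_eq_natAbs]
    rw [h1]
    have h2 := Int.mul_ediv_add_emod (2 * a + |D|) (2 * |D|)
    have h3 := Int.emod_nonneg (2 * a + |D|) (b := 2 * |D|) (by omega)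
    have h4 := Int.emod_lt_of_pos (2 * a + |D|) (b := 2 * |D|) (by omega)
    rw [← abs_two, ← abs_mul, abs_two, abs_le]
    constructor <;> nlinarith
  obtain ⟨q1, h1⟩ := round c.re
  obtain ⟨q2, h2⟩ := round c.im
  refine ⟨⟨q1, q2⟩, ?_⟩
  have h3 : (x - y * ⟨q1, q2⟩) * yc = ⟨c.re - D * q1, c.im - D * q2⟩ := by
    have : (x - y * ⟨q1, q2⟩) * yc = c - (y * yc) * ⟨q1, q2⟩ := by rw [hc]; ring
    rw [this, hyy]; ext <;> simp
  have h4 : nm (x - y * ⟨q1, q2⟩) * D = nm ⟨c.re - D * q1, c.im - D * q2⟩ := by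
    rw [← h3, nm_mul, hyyc]
  set u := c.re - D * q1
  set v := c.im - D * q2
  have h5 : |nm ⟨u, v⟩| < |D| * |D| := by
    have hD0 : 0 < |D| := abs_pos.2 hn
    simp only [nm]
    have a1 := abs_le.1 (show |2 * u| ≤ |D| by rw [abs_mul, abs_two]; exact h1)
    have a2 := abs_le.1 (show |2 * v| ≤ |D| by rw [abs_mul, abs_two]; exact h2)
    rw [abs_lt]
    constructor <;> nlinarith [sq_nonneg (u+v), sq_nonneg (u - v)]
  rw [← h4, abs_mul] at h5
  have h6 := lt_of_mul_lt_mul_right h5 (abs_nonneg D)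
  rw [Int.abs_eq_natAbs, Int.abs_eq_natAbs] at h6
  exact_mod_cast h6

instance : IsPrincipalIdealRing O where
  principal I := by
    by_cases hI : I = ⊥
    · subst hI; infer_instance
    obtain ⟨x0, hx0, hx0n⟩ := Submodule.exists_mem_ne_zero_of_ne_bot hI
    classical
    have hex : ∃ n, ∃ x ∈ I, x ≠ 0 ∧ (nm x).natAbs = n := ⟨_, x0, hx0, hx0n, rfl⟩
    obtain ⟨b, hb, hbn, hbe⟩ := Nat.find_spec hex
    refine ⟨b, le_antisymm ?_ ?_⟩
    · intro a ha
      obtain ⟨q, hq⟩ := O_div a b hbn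
      have hmem : a - b * q ∈ I := I.sub_mem ha (I.mul_mem_right _ hb)
      by_cases h0 : a - b * q = 0
      · exact Ideal.mem_span_singleton'.2 ⟨q, by rw [mul_comm]; exact (sub_eq_zero.1 h0).symm⟩
      · exfalso
        rw [hbe] at hq
        exact Nat.find_min hex hq ⟨_, hmem, h0, rfl⟩
    · exact (Ideal.span_singleton_le_iff_mem I).2 hb

end FS5

namespace FS5
open QuadraticAlgebra

/-- Lipschitz quaternions over `O` -/
abbrev H := QuaternionAlgebra O (-1) 0 (-1)

/-- sum of four squares -/
def nsq (y : H) : O := y.re ^ 2 + y.imI ^ 2 + y.imJ ^ 2 + y.imK ^ 2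

theorem nsq_mul (x y : H) : nsq (x * y) = nsq x * nsq y := by
  simp [nsq]; ring

theorem nsq_smul (a : O) (x : H) : nsq (a • x) = a ^ 2 * nsq x := by
  simp [nsq]; ring

/-- conjugate -/
def cj (y : H) : H := ⟨y.re, -y.imI, -y.imJ, -y.imK⟩

theorem cj_cj (y : H) : cj (cj y) = y := by ext1 <;> simp [cj]

theorem nsq_cj (y : H) : nsq (cj y) = nsq y := by simp [nsq, cj]

theorem mul_cj (y : H) : y * cj y = nsq y • (1 : H) := by
  ext1 <;> simp [nsq, cj] <;> ring

/-- twice the icosian ring, as a submodule of the Lipschitz quaternions -/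
def J : Submodule O H where
  carrier := {y | ∃ u v : O, y.imJ = y.re + (1 + ph) * (y.imI - y.re) + 2 * u ∧
    y.imK = y.re + ph * (y.imI - y.re) + 2 * v}
  zero_mem' := ⟨0, 0, by simp, by simp⟩
  add_mem' := by
    rintro a b ⟨u, v, h1, h2⟩ ⟨u', v', h3, h4⟩
    refine ⟨u + u', v + v', ?_, ?_⟩
    · simp only [QuaternionAlgebra.re_add, QuaternionAlgebra.imI_add, QuaternionAlgebra.imJ_add]
      rw [h1, h3]; ring
    · simp only [QuaternionAlgebra.re_add, QuaternionAlgebra.imI_add, QuaternionAlgebra.imK_add]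
      rw [h2, h4]; ring
  smul_mem' := by
    rintro c a ⟨u, v, h1, h2⟩
    refine ⟨c * u, c * v, ?_, ?_⟩
    · simp only [QuaternionAlgebra.re_smul, QuaternionAlgebra.imI_smul, QuaternionAlgebra.imJ_smul, smul_eq_mul]
      rw [h1]; ring
    · simp only [QuaternionAlgebra.re_smul, QuaternionAlgebra.imI_smul, QuaternionAlgebra.imK_smul, smul_eq_mul]
      rw [h2]; ring

/-- parity description of `J` -/
def par (y : H) : Prop :=
  2 ∣ y.imJ.re - y.imI.re - y.re.im - y.imI.im ∧
  2 ∣ y.imJ.im - y.re.re - y.imI.re - y.re.im ∧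
  2 ∣ y.imK.re - y.re.re - y.re.im - y.imI.im ∧
  2 ∣ y.imK.im - y.re.re - y.imI.re - y.imI.im

theorem mem_J_iff (y : H) : y ∈ J ↔ par y := by
  constructor
  · rintro ⟨u, v, h1, h2⟩
    have a1 := congrArg QuadraticAlgebra.re h1
    have a2 := congrArg QuadraticAlgebra.im h1
    have a3 := congrArg QuadraticAlgebra.re h2
    have a4 := congrArg QuadraticAlgebra.im h2
    simp [ph, QuadraticAlgebra.re_one, QuadraticAlgebra.im_one] at a1 a2 a3 a4
    refine ⟨?_, ?_, ?_, ?_⟩ <;> omega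
  · rintro ⟨⟨k1, h1⟩, ⟨k2, h2⟩, ⟨k3, h3⟩, ⟨k4, h4⟩⟩
    refine ⟨⟨k1 + y.re.im, k2 + y.re.im + y.re.re - y.imI.im⟩, ⟨k3 + y.re.im, k4 + y.re.re⟩, ?_, ?_⟩
    · ext <;> simp [ph, QuadraticAlgebra.re_one, QuadraticAlgebra.im_one] <;> linarith
    · ext <;> simp [ph, QuadraticAlgebra.re_one, QuadraticAlgebra.im_one] <;> linarith

instance (y : H) : Decidable (par y) := by unfold par; infer_instance

/-- basis -/
def bas : Fin 4 → H :=
  ![⟨1, 1, 1, 1⟩, ⟨0, 1, ⟨1, 1⟩, ⟨0, 1⟩⟩, ⟨0, 0, 2, 0⟩, ⟨0, 0, 0, 2⟩]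

/-- halving -/
def halfO (x : O) : O := ⟨x.re / 2, x.im / 2⟩
def half (y : H) : H := ⟨halfO y.re, halfO y.imI, halfO y.imJ, halfO y.imK⟩

instance : DecidableEq H := fun x y =>
  decidable_of_iff (x.re = y.re ∧ x.imI = y.imI ∧ x.imJ = y.imJ ∧ x.imK = y.imK)
    (by rw [QuaternionAlgebra.ext_iff])

theorem bas_mul : ∀ i j, bas i * bas j = (2 : O) • half (bas i * bas j) ∧ par (half (bas i * bas j)) := by
  decide +kernel

theorem bas_mem : ∀ i, par (bas i) := by decide +kernel

theorem mem_J_iff_bas (y : H) : y ∈ J ↔ ∃ x : Fin 4 → O, y = ∑ i, x i • bas i := by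
  constructor
  · rintro ⟨u, v, h1, h2⟩
    refine ⟨![y.re, y.imI - y.re, u, v], ?_⟩
    simp only [Fin.sum_univ_four, bas]
    ext1
    · simp
    · simp
    · simp [h1]
      have : (⟨1,1⟩ : O) = 1 + ph := by decide
      rw [this]; ring
    · simp [h2]
      have : (⟨0,1⟩ : O) = ph := by decide
      rw [this]; ring
  · rintro ⟨x, rfl⟩
    exact Submodule.sum_mem _ fun i _ => J.smul_mem _ ((mem_J_iff _).2 (bas_mem i))

theorem J_mul {y z : H} (hy : y ∈ J) (hz : z ∈ J) : ∃ w ∈ J, y * z = (2 : O) • w := by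
  obtain ⟨a, rfl⟩ := (mem_J_iff_bas y).1 hy
  obtain ⟨b, rfl⟩ := (mem_J_iff_bas z).1 hz
  refine ⟨∑ i, ∑ j, (a i * b j) • half (bas i * bas j), ?_, ?_⟩
  · exact Submodule.sum_mem _ fun i _ => Submodule.sum_mem _ fun j _ =>
      J.smul_mem _ ((mem_J_iff _).2 (bas_mul i j).2)
  · rw [Finset.sum_mul_sum, Finset.smul_sum]
    refine Finset.sum_congr rfl fun i _ => ?_
    rw [Finset.smul_sum]
    refine Finset.sum_congr rfl fun j _ => ?_
    rw [smul_mul_smul_comm, smul_comm, ← (bas_mul i j).1]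

/-- The ring of icosians. The element `y` stands for `y / 2`. -/
def Ico : Type := ↥J

noncomputable instance : AddCommGroup Ico := inferInstanceAs (AddCommGroup ↥J)
noncomputable instance : Module O Ico := inferInstanceAs (Module O ↥J)

namespace Ico

/-- twice the icosian -/
noncomputable def v : Ico →ₗ[O] H := J.subtype

theorem v_inj : Function.Injective v := Subtype.val_injective

theorem v_mem (x : Ico) : v x ∈ J := x.2

noncomputable def mk (y : H) (h : y ∈ J) : Ico := ⟨y, h⟩
@[simp] theorem v_mk (y : H) (h : y ∈ J) : v (mk y h) = y := rfl

noncomputable instance : Mul Ico where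
  mul x y := mk (J_mul x.2 y.2).choose (J_mul x.2 y.2).choose_spec.1

theorem two_v_mul (x y : Ico) : (2 : O) • v (x * y) = v x * v y :=
  (J_mul x.2 y.2).choose_spec.2.symm

noncomputable instance : One Ico where
  one := mk ⟨2, 0, 0, 0⟩ ((mem_J_iff _).2 (by decide +kernel))

theorem v_one : v 1 = ⟨2, 0, 0, 0⟩ := rfl

theorem v_one' : v 1 = (2 : O) • (1 : H) := by
  rw [v_one]; ext1 <;> simp

theorem two_smul_inj {a b : H} (h : (2 : O) • a = (2 : O) • b) : a = b := by
  rw [QuaternionAlgebra.ext_iff] at h ⊢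
  simp only [QuaternionAlgebra.re_smul, QuaternionAlgebra.imI_smul, QuaternionAlgebra.imJ_smul, QuaternionAlgebra.imK_smul,
    smul_eq_mul] at h
  have h2 : (2 : O) ≠ 0 := by decide
  exact ⟨mul_left_cancel₀ h2 h.1, mul_left_cancel₀ h2 h.2.1, mul_left_cancel₀ h2 h.2.2.1,
    mul_left_cancel₀ h2 h.2.2.2⟩

theorem ext2 {a b : Ico} (h : (2 : O) • v a = (2 : O) • v b) : a = b :=
  v_inj (two_smul_inj h)

noncomputable instance : Ring Ico where
  __ := (inferInstance : AddCommGroup Ico)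
  mul := (· * ·)
  one := 1
  mul_assoc a b c := by
    apply ext2; apply two_smul_inj
    rw [two_v_mul, two_v_mul, ← smul_mul_assoc, ← mul_smul_comm, two_v_mul, two_v_mul, mul_assoc]
  one_mul a := by
    apply ext2
    rw [two_v_mul, v_one', smul_mul_assoc, one_mul]
  mul_one a := by
    apply ext2
    rw [two_v_mul, v_one', mul_smul_comm, mul_one]
  left_distrib a b c := by
    apply ext2
    rw [two_v_mul, map_add, map_add, smul_add, two_v_mul, two_v_mul, mul_add]
  right_distrib a b c := by
    apply ext2
    rw [two_v_mul, map_add, map_add, smul_add, two_v_mul, two_v_mul, add_mul]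
  zero_mul a := by
    apply ext2
    rw [two_v_mul, map_zero, zero_mul, smul_zero]
  mul_zero a := by
    apply ext2
    rw [two_v_mul, map_zero, mul_zero, smul_zero]

theorem smul_mul' (a : O) (x y : Ico) : (a • x) * y = a • (x * y) := by
  apply ext2
  rw [two_v_mul, map_smul, map_smul, smul_comm, two_v_mul, smul_mul_assoc]

theorem mul_smul' (a : O) (x y : Ico) : x * (a • y) = a • (x * y) := by
  apply ext2
  rw [two_v_mul, map_smul, map_smul, smul_comm, two_v_mul, mul_smul_comm]

noncomputable instance : Algebra O Ico := Algebra.ofModule smul_mul' mul_smul'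

/-- conjugation -/
noncomputable def conj (x : Ico) : Ico := mk (cj (v x)) (by
  have := (mem_J_iff _).1 (v_mem x)
  rw [mem_J_iff]
  simp only [par, cj,
    QuadraticAlgebra.re_neg, QuadraticAlgebra.im_neg] at this ⊢
  omega)

theorem v_conj (x : Ico) : v (conj x) = cj (v x) := rfl

theorem conj_conj (x : Ico) : conj (conj x) = x := by
  apply v_inj; rw [v_conj, v_conj, cj_cj]

theorem exists_nrm (x : Ico) : ∃ n : O, nsq (v x) = 4 * n := by
  obtain ⟨u, w, h1, h2⟩ := v_mem x
  set y := v x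
  have hph : ph * ph = ph + 1 := by decide
  refine ⟨y.re ^ 2 + (1 + ph) * y.re * (y.imI - y.re) + (1 + ph) * (y.imI - y.re) ^ 2 + y.re * (u + w)
    + (1 + ph) * (y.imI - y.re) * u + ph * (y.imI - y.re) * w + u ^ 2 + w ^ 2, ?_⟩
  rw [nsq, h1, h2]
  linear_combination (2 * (y.imI - y.re) ^ 2) * hph

/-- reduced norm -/
noncomputable def nrm (x : Ico) : O := (exists_nrm x).choose
theorem four_nrm (x : Ico) : 4 * nrm x = nsq (v x) := (exists_nrm x).choose_spec.symm

theorem four_ne : (4 : O) ≠ 0 := by decide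

theorem nrm_mul (x y : Ico) : nrm (x * y) = nrm x * nrm y := by
  have h := congrArg nsq (two_v_mul x y)
  rw [nsq_mul, ← four_nrm, ← four_nrm, nsq_smul, ← four_nrm] at h
  have h16 : (16 : O) ≠ 0 := by decide
  apply mul_left_cancel₀ h16
  linear_combination h

theorem nrm_smul (a : O) (x : Ico) : nrm (a • x) = a ^ 2 * nrm x := by
  apply mul_left_cancel₀ four_ne
  rw [four_nrm, map_smul, nsq_smul, ← four_nrm]; ring

theorem nrm_one : nrm 1 = 1 := by
  apply mul_left_cancel₀ four_ne
  rw [four_nrm, v_one, nsq]; decide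

theorem nrm_conj (x : Ico) : nrm (conj x) = nrm x := by
  apply mul_left_cancel₀ four_ne
  rw [four_nrm, four_nrm, v_conj, nsq_cj]

theorem mul_conj (x : Ico) : x * conj x = nrm x • (1 : Ico) := by
  apply ext2
  rw [two_v_mul, v_conj, mul_cj, ← four_nrm, map_smul, v_one']
  ext1 <;> simp
  ring

theorem conj_mul (x : Ico) : conj x * x = nrm x • (1 : Ico) := by
  have := mul_conj (conj x)
  rwa [conj_conj, nrm_conj] at this

/-- coordinates of the norm -/
theorem four_nrm_re (x : Ico) : 4 * (nrm x).re = (v x).re.re ^ 2 + (v x).re.im ^ 2 +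
    (v x).imI.re ^ 2 + (v x).imI.im ^ 2 + (v x).imJ.re ^ 2 + (v x).imJ.im ^ 2 +
    (v x).imK.re ^ 2 + (v x).imK.im ^ 2 := by
  have := congrArg QuadraticAlgebra.re (four_nrm x)
  rw [nsq] at this
  simp [sq] at this
  rw [this]; ring

theorem v_eq_zero {x : Ico} (h : v x = 0) : x = 0 := v_inj (by rw [h, map_zero])

theorem e_nrm_nonneg (f : O →+* ℝ) (x : Ico) : 0 ≤ f (nrm x) := by
  have := congrArg f (four_nrm x)
  rw [nsq] at this
  simp only [map_mul, map_add, map_pow, map_ofNat] at this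
  nlinarith [sq_nonneg (f (v x).re), sq_nonneg (f (v x).imI), sq_nonneg (f (v x).imJ), sq_nonneg (f (v x).imK)]

theorem nrm_eq_zero {x : Ico} : nrm x = 0 ↔ x = 0 := by
  constructor
  · intro h
    have h1 := four_nrm_re x
    rw [h] at h1
    apply v_eq_zero
    simp at h1
    have e : ∀ a : ℤ, a ^ 2 ≤ 0 → a = 0 := fun a ha => by nlinarith
    ext1 <;> ext <;> apply e <;> nlinarith [sq_nonneg (v x).re.re, sq_nonneg (v x).re.im,
      sq_nonneg (v x).imI.re, sq_nonneg (v x).imI.im, sq_nonneg (v x).imJ.re, sq_nonneg (v x).imJ.im,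
      sq_nonneg (v x).imK.re, sq_nonneg (v x).imK.im]
  · rintro rfl
    apply mul_left_cancel₀ four_ne
    rw [four_nrm]; simp [nsq]

instance : NoZeroDivisors Ico where
  eq_zero_or_eq_zero_of_mul_eq_zero {a b} h := by
    have h2 := nrm_mul a b
    rw [h, nrm_eq_zero.2 rfl] at h2
    rcases mul_eq_zero.1 h2.symm with h | h
    · exact Or.inl (nrm_eq_zero.1 h)
    · exact Or.inr (nrm_eq_zero.1 h)

instance : Nontrivial Ico := ⟨1, 0, fun h => by
  have := congrArg nrm h
  rw [nrm_one, nrm_eq_zero.2 rfl] at this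
  exact one_ne_zero this⟩

instance : IsDomain Ico := NoZeroDivisors.to_isDomain _

theorem nrm_tp {x : Ico} (h : x ≠ 0) : TP (nrm x) := by
  have h0 : nrm x ≠ 0 := fun h' => h (nrm_eq_zero.1 h')
  have hn : nm (nrm x) ≠ 0 := fun h => h0 (nm_eq_zero.1 h)
  have h3 : e1 (nrm x) * e2 (nrm x) ≠ 0 := by
    rw [← nm_eq]; exact_mod_cast hn
  exact ⟨lt_of_le_of_ne (e_nrm_nonneg _ _) (left_ne_zero_of_mul h3).symm,
    lt_of_le_of_ne (e_nrm_nonneg _ _) (right_ne_zero_of_mul h3).symm⟩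

end Ico
end FS5

namespace FS5
open QuadraticAlgebra

/-- the extended Hamming code -/
def Cd (n : Fin 8 → ZMod 2) : Prop :=
  n 4 = n 2 + n 1 + n 3 ∧ n 5 = n 0 + n 2 + n 1 ∧ n 6 = n 0 + n 1 + n 3 ∧ n 7 = n 0 + n 2 + n 3

instance (n : Fin 8 → ZMod 2) : Decidable (Cd n) := by unfold Cd; infer_instance

/-- matchings -/
def mat : Fin 7 → Fin 8 → Fin 8 :=
  ![![1, 0, 5, 6, 7, 2, 3, 4], ![2, 5, 0, 7, 6, 1, 4, 3], ![3, 6, 7, 0, 5, 4, 1, 2],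
    ![4, 7, 6, 5, 0, 3, 2, 1], ![5, 2, 1, 4, 3, 0, 7, 6], ![6, 3, 4, 1, 2, 7, 0, 5],
    ![7, 4, 3, 2, 1, 6, 5, 0]]

theorem Cd_cover : ∀ n : Fin 8 → ZMod 2, Cd n ∨ (∃ i, Cd (n + Pi.single i 1)) ∨
    ∃ s, ∀ i, Cd (n + Pi.single i 1 + Pi.single (mat s i) 1) := by
  decide +kernel

theorem mat_ne : ∀ s i, i ≠ mat s i := by decide
theorem mat_inv : ∀ s i, mat s (mat s i) = i := by decide

theorem approx (z : Fin 8 → ℤ) (D : ℤ) (hD : 0 < D) :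
    ∃ w : Fin 8 → ℤ, Cd (fun k => (w k : ZMod 2)) ∧ ∑ k, (z k - D * w k) ^ 2 ≤ 3 * D ^ 2 := by
  have round : ∀ a : ℤ, ∃ q : ℤ, 2 * |a - D * q| ≤ D := by
    intro a
    refine ⟨(2 * a + D) / (2 * D), ?_⟩
    have h2 := Int.mul_ediv_add_emod (2 * a + D) (2 * D)
    have h3 := Int.emod_nonneg (2 * a + D) (b := 2 * D) (by omega)
    have h4 := Int.emod_lt_of_pos (2 * a + D) (b := 2 * D) (by omega)
    rw [← abs_two, ← abs_mul, abs_two, abs_le]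
    constructor <;> nlinarith
  choose n hn using fun k => round (z k)
  set f : Fin 8 → ℤ := fun k => z k - D * n k with hf
  have hfk : ∀ k, z k = f k + D * n k := fun k => by simp [hf]
  have hsg : ∀ k, ∃ s : ℤ, s ^ 2 = 1 ∧ ((s : ZMod 2) = 1) ∧ f k * s = |f k| := by
    intro k
    rcases le_total 0 (f k) with h | h
    · exact ⟨1, by norm_num, by norm_num, by rw [abs_of_nonneg h]; ring⟩
    · exact ⟨-1, by norm_num, by push_cast; decide, by rw [abs_of_nonpos h]; ring⟩
  choose sg h1 h2 h3 using hsg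
  have hfsq : ∀ k, 2 * f k ^ 2 ≤ D * |f k| := by
    intro k
    have := hn k
    have h0 := abs_nonneg (f k)
    rw [← sq_abs]
    nlinarith
  have hS2 : ∑ k, f k ^ 2 ≤ 2 * D ^ 2 := by
    have : ∀ k ∈ Finset.univ, 4 * f k ^ 2 ≤ D ^ 2 := by
      intro k _
      have := hn k
      have h0 := abs_nonneg (f k)
      rw [← sq_abs]
      nlinarith
    have := Finset.sum_le_sum this
    rw [← Finset.mul_sum] at this
    simp at this
    linarith
  rcases Cd_cover (fun k => (n k : ZMod 2)) with h | ⟨i, h⟩ | ⟨s, h⟩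
  · refine ⟨n, h, ?_⟩
    have : ∑ k, (z k - D * n k) ^ 2 = ∑ k, f k ^ 2 := rfl
    rw [this]; nlinarith
  · refine ⟨n + Pi.single i (sg i), ?_, ?_⟩
    · convert h using 1
      funext k
      by_cases hk : k = i
      · subst hk; simp [h2]
      · simp [hk]
    · have e : ∑ k, (z k - D * (n + Pi.single i (sg i) : Fin 8 → ℤ) k) ^ 2 =
        ∑ k, f k ^ 2 - 2 * D * |f i| + D ^ 2 := by
        have : ∀ k, (z k - D * (n + Pi.single i (sg i) : Fin 8 → ℤ) k) ^ 2 =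
          f k ^ 2 + (if k = i then D ^ 2 - 2 * D * |f i| else 0) := by
          intro k
          rw [hfk k]
          by_cases hk : k = i
          · subst hk
            simp
            linear_combination D ^ 2 * h1 k - 2 * D * h3 k
          · simp [hk]
        simp only [this, Finset.sum_add_distrib, Finset.sum_ite_eq', Finset.mem_univ, if_true]
        ring
      rw [e]
      nlinarith [mul_nonneg hD.le (abs_nonneg (f i))]
  · have e : ∀ i, ∑ k, (z k - D * (n + Pi.single i (sg i) + Pi.single (mat s i) (sg (mat s i)) :
        Fin 8 → ℤ) k) ^ 2 =
        ∑ k, f k ^ 2 + (D ^ 2 - 2 * D * |f i|) + (D ^ 2 - 2 * D * |f (mat s i)|) := by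
      intro i
      have hne := mat_ne s i
      have : ∀ k, (z k - D * (n + Pi.single i (sg i) + Pi.single (mat s i) (sg (mat s i)) :
        Fin 8 → ℤ) k) ^ 2 =
        f k ^ 2 + (if k = i then D ^ 2 - 2 * D * |f i| else 0) +
          (if k = mat s i then D ^ 2 - 2 * D * |f (mat s i)| else 0) := by
        intro k
        rw [hfk k]
        by_cases hk : k = i
        · subst hk
          simp [hne]
          linear_combination D ^ 2 * h1 k - 2 * D * h3 k
        · by_cases hk' : k = mat s i
          · rw [hk'] at *
            simp [hne.symm]
            linear_combination D ^ 2 * h1 (mat s i) - 2 * D * h3 (mat s i)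
          · simp [hk, hk']
      simp only [this, Finset.sum_add_distrib, Finset.sum_ite_eq', Finset.mem_univ, if_true]
    have hex : ∃ i ∈ (Finset.univ : Finset (Fin 8)), ∑ k, f k ^ 2 + (D ^ 2 - 2 * D * |f i|) + (D ^ 2 - 2 * D * |f (mat s i)|)
        ≤ 3 * D ^ 2 := by
      apply Finset.exists_le_of_sum_le (Finset.univ_nonempty)
      have hperm : ∑ i, |f (mat s i)| = ∑ i, |f i| :=
        Fintype.sum_bijective (mat s) (Function.Involutive.bijective (mat_inv s)) _ _ (fun _ => rfl)
      have hSf := Finset.sum_le_sum (fun k (_ : k ∈ Finset.univ) => hfsq k)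
      rw [← Finset.mul_sum, ← Finset.mul_sum] at hSf
      simp only [Finset.sum_add_distrib, Finset.sum_sub_distrib, ← Finset.mul_sum, hperm]
      simp
      nlinarith [sq_nonneg D]
    obtain ⟨i, -, hi⟩ := hex
    refine ⟨_, ?_, (e i).trans_le hi⟩
    convert h i using 1
    have hne := mat_ne s i
    funext k
    by_cases hk : k = i
    · subst hk; simp [h2, hne]
    · by_cases hk' : k = mat s i
      · rw [hk'] at *; simp [h2, hne.symm]
      · simp [hk, hk']

namespace Ico

theorem approx_ico (c : Ico) (D : ℤ) (hD : 0 < D) :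
    ∃ g : Ico, 4 * (nrm (c - (D : O) • g)).re ≤ 3 * D ^ 2 := by
  obtain ⟨w, hw, hs⟩ := approx ![(v c).re.re, (v c).re.im, (v c).imI.re, (v c).imI.im,
    (v c).imJ.re, (v c).imJ.im, (v c).imK.re, (v c).imK.im] D hD
  have hmem : (⟨⟨w 0, w 1⟩, ⟨w 2, w 3⟩, ⟨w 4, w 5⟩, ⟨w 6, w 7⟩⟩ : H) ∈ J := by
    rw [mem_J_iff]
    simp only [Cd] at hw
    obtain ⟨a1, a2, a3, a4⟩ := hw
    refine ⟨?_, ?_, ?_, ?_⟩ <;> simp only <;>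
      rw [show (2 : ℤ) = ((2 : ℕ) : ℤ) from rfl, ← ZMod.intCast_zmod_eq_zero_iff_dvd] <;> push_cast
    · rw [a1]; ring
    · rw [a2]; ring
    · rw [a3]; ring
    · rw [a4]; ring
  refine ⟨mk _ hmem, ?_⟩
  rw [four_nrm_re, map_sub, map_smul, v_mk]
  refine le_trans (le_of_eq ?_) hs
  simp [Fin.sum_univ_eight]

theorem nm_le (x : O) : 4 * nm x ≤ 5 * x.re ^ 2 := by
  simp only [nm]; nlinarith [sq_nonneg (x.re - 2 * x.im)]

/-- the absolute norm -/
noncomputable def an (x : Ico) : ℕ := (nm (nrm x)).natAbs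

theorem nm_nrm_nonneg (x : Ico) : 0 ≤ nm (nrm x) := by
  by_cases h : x = 0
  · subst h; rw [nrm_eq_zero.2 rfl, nm_eq_zero.2 rfl]
  · exact (nrm_tp h).nm_pos.le

theorem re_nrm_nonneg (x : Ico) : 0 ≤ (nrm x).re := by
  by_cases h : x = 0
  · subst h; rw [nrm_eq_zero.2 rfl]; simp
  · exact (nrm_tp h).re_pos.le

theorem ico_div (a b : Ico) (hb : b ≠ 0) : ∃ g : Ico, an (a - b * g) < an b := by
  set n := nrm b with hn
  set n' : O := ⟨n.re + n.im, -n.im⟩ with hn'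
  set D := nm n with hDdef
  have hD : 0 < D := (nrm_tp hb).nm_pos
  have hnn : n' * n = (D : O) := by
    have hc : ∀ k : ℤ, (k : O) = ⟨k, 0⟩ := fun _ => rfl
    rw [hc, hDdef, hn']; ext <;> simp [nm] <;> ring
  have hnm' : nm n' = D := by
    rw [hDdef, hn']; simp [nm]; ring
  obtain ⟨g, hg⟩ := approx_ico (n' • (conj b * a)) D hD
  refine ⟨g, ?_⟩
  have e : n' • (conj b * (a - b * g)) = n' • (conj b * a) - (D : O) • g := by
    rw [mul_sub, ← mul_assoc, conj_mul, smul_sub, smul_mul', one_mul, smul_smul, hnn]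
  rw [← e] at hg
  set X := n' • (conj b * (a - b * g)) with hX
  have h1 := nm_le (nrm X)
  have h2 : nm (nrm X) = D ^ 3 * nm (nrm (a - b * g)) := by
    rw [hX, nrm_smul, nrm_mul, nrm_conj, sq, nm_mul, nm_mul, nm_mul, hnm']; ring
  have h3 := re_nrm_nonneg X
  have h4 : nm (nrm (a - b * g)) < D := by
    have h5 : 16 * (nrm X).re ^ 2 ≤ 9 * D ^ 4 := by nlinarith
    have h6 : D ^ 3 * (64 * nm (nrm (a - b * g))) ≤ D ^ 3 * (45 * D) := by nlinarith
    have h7 := le_of_mul_le_mul_left h6 (by positivity)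
    linarith
  have h5 := nm_nrm_nonneg (a - b * g)
  unfold an
  rw [← hn, ← hDdef]
  omega

/-- Right ideals generated by two elements are principal. -/
theorem exists_gcd (a b : Ico) (hb : b ≠ 0) :
    ∃ g : Ico, g ∣ a ∧ g ∣ b ∧ ∃ x y, g = a * x + b * y := by
  classical
  have hex : ∃ n, ∃ x y : Ico, a * x + b * y ≠ 0 ∧ an (a * x + b * y) = n :=
    ⟨_, 0, 1, by simpa using hb, rfl⟩
  obtain ⟨x, y, hne, hxy⟩ := Nat.find_spec hex
  have key : ∀ s t : Ico, (a * x + b * y) ∣ a * s + b * t := by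
    intro s t
    obtain ⟨q, hq⟩ := ico_div (a * s + b * t) (a * x + b * y) hne
    have e : a * s + b * t - (a * x + b * y) * q = a * (s - x * q) + b * (t - y * q) := by
      noncomm_ring
    by_cases h0 : a * s + b * t - (a * x + b * y) * q = 0
    · exact ⟨q, sub_eq_zero.1 h0⟩
    · exfalso
      rw [hxy] at hq
      exact Nat.find_min hex hq ⟨_, _, e ▸ h0, by rw [e]⟩
  refine ⟨a * x + b * y, ?_, ?_, x, y, rfl⟩
  · simpa using key 1 0
  · simpa using key 0 1

end Ico
end FS5

namespace FS5
open QuadraticAlgebra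
namespace Ico

/-- icosians of given norm -/
abbrev S (m : O) := {x : Ico // nrm x = m}

theorem sq_le_abs {a B : ℤ} (h : a ^ 2 ≤ B) : a ∈ Set.Icc (-B) B := by
  constructor <;> nlinarith [sq_nonneg (a - 1), sq_nonneg (a + 1), sq_nonneg a]

instance finS (m : O) : Finite (S m) := by
  have hb : ∀ x : S m, ∀ i, ![(v x.1).re.re, (v x.1).re.im, (v x.1).imI.re, (v x.1).imI.im,
    (v x.1).imJ.re, (v x.1).imJ.im, (v x.1).imK.re, (v x.1).imK.im] i ∈ Set.Icc (-(4 * m.re)) (4 * m.re) := by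
    intro x i
    apply sq_le_abs
    have := four_nrm_re x.1
    rw [x.2] at this
    rw [this]
    fin_cases i <;> simp <;> nlinarith [sq_nonneg (v x.1).re.re, sq_nonneg (v x.1).re.im,
      sq_nonneg (v x.1).imI.re, sq_nonneg (v x.1).imI.im, sq_nonneg (v x.1).imJ.re, sq_nonneg (v x.1).imJ.im,
      sq_nonneg (v x.1).imK.re, sq_nonneg (v x.1).imK.im]
  let f : S m → (Fin 8 → Set.Icc (-(4 * m.re)) (4 * m.re)) := fun x i => ⟨_, hb x i⟩
  apply Finite.of_injective f
  intro x y h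
  have h' : ∀ i, (f x i).1 = (f y i).1 := fun i => by rw [h]
  apply Subtype.ext
  apply v_inj
  ext1 <;> ext
  · exact h' 0
  · exact h' 1
  · exact h' 2
  · exact h' 3
  · exact h' 4
  · exact h' 5
  · exact h' 6
  · exact h' 7

/-- number of icosians of given norm -/
noncomputable def r (m : O) : ℕ := Nat.card (S m)

theorem gcd_prime {π : O} (hπ : Prime π) (hT : TP π) {α : Ico} (h1 : π ∣ nrm α)
    (h2 : ¬ ∃ α', α = π • α') : ∃ β, nrm β = π ∧ β ∣ α ∧
      ∀ β', nrm β' = π → β' ∣ α → β' ∣ β := by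
  have hne : π • (1 : Ico) ≠ 0 := by
    intro h
    have := congrArg nrm h
    rw [nrm_smul, nrm_one, nrm_eq_zero.2 rfl, mul_one] at this
    exact hπ.ne_zero (pow_eq_zero_iff (two_ne_zero) |>.1 this)
  obtain ⟨g, ⟨s, hs⟩, ⟨t, ht⟩, x, y, hg⟩ := exists_gcd α (π • 1) hne
  have hg0 : g ≠ 0 := by
    rintro rfl
    rw [zero_mul] at ht; exact hne ht
  have ht0 : t ≠ 0 := by
    rintro rfl
    rw [mul_zero] at ht; exact hne ht
  have hnt : π ^ 2 = nrm g * nrm t := by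
    rw [← nrm_mul, ← ht, nrm_smul, nrm_one, mul_one]
  obtain ⟨i, hi, hgi⟩ := (dvd_prime_pow hπ 2).1 (Dvd.intro _ hnt.symm)
  have hass : Associated (nrm g) π := by
    interval_cases i
    · exfalso
      rw [pow_zero, associated_one_iff_isUnit] at hgi
      -- nrm (g - π y) is divisible by π
      have e : g - π • y = α * x := by
        rw [hg, smul_mul', one_mul]; abel
      have d1 : π ∣ nrm (g - π • y) := by
        rw [e, nrm_mul]; exact h1.mul_right _
      -- g * conj ...
      have e2 : nrm (g - π • y) • (1 : Ico) = nrm g • (1 : Ico) - π • (g * conj y + y * conj (g - π • y)) := by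
        have hc : conj (g - π • y) = conj g - π • conj y := by
          apply v_inj
          rw [map_sub, map_smul, v_conj, v_conj, v_conj, map_sub, map_smul]
          ext1 <;> simp [cj]
          all_goals ring
        rw [← mul_conj, ← mul_conj]
        nth_rw 1 [hc]
        rw [sub_mul, mul_sub, smul_add, smul_mul', mul_smul', hc]
        abel
      obtain ⟨k, hk⟩ := d1
      obtain ⟨u, hu⟩ := hgi.exists_right_inv
      have e3 : (1 : Ico) = π • (u • (k • (1 : Ico) + (g * conj y + y * conj (g - π • y)))) := by
        rw [hk, mul_smul, eq_sub_iff_add_eq, ← smul_add] at e2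
        rw [smul_comm, e2, smul_smul, mul_comm, hu, one_smul]
      have e4 := congrArg nrm e3
      rw [nrm_one, nrm_smul] at e4
      exact hπ.not_isUnit (isUnit_of_dvd_one ((dvd_pow_self π two_ne_zero).trans (Dvd.intro _ e4.symm)))
    · simpa using hgi
    · exfalso
      apply h2
      -- nrm t is a unit
      have hu : IsUnit (nrm t) := by
        obtain ⟨w, hw⟩ := hgi.symm
        have : nrm g * nrm t = nrm g * (w⁻¹ : Oˣ) := by rw [← hnt, ← hw]; simp
        have := mul_left_cancel₀ (fun h => hg0 (nrm_eq_zero.1 h)) this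
        rw [this]; exact Units.isUnit _
      obtain ⟨u, hu⟩ := hu.exists_right_inv
      refine ⟨u • (conj t * s), ?_⟩
      have : g = π • (u • conj t) := by
        have h3 : π • conj t = nrm t • g := by
          rw [← one_mul (conj t), ← smul_mul', ht, mul_assoc, mul_conj, mul_smul', mul_one]
        rw [smul_comm, h3, smul_smul, mul_comm, hu, one_smul]
      conv_lhs => rw [hs, this]
      rw [smul_mul', smul_mul']
  obtain ⟨w, hw⟩ := hass
  have hwT : TP (w : O) := (nrm_tp hg0).of_mul (hw ▸ hT)
  obtain ⟨ε, hε⟩ := tp_unit_sq hwT w.isUnit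
  have hεu : IsUnit ε := by
    rw [← isUnit_pow_iff two_ne_zero, hε]; exact w.isUnit
  obtain ⟨ε', hε'⟩ := hεu.exists_right_inv
  refine ⟨ε • g, ?_, ?_, ?_⟩
  · rw [nrm_smul, hε, mul_comm, hw]
  · refine ⟨ε' • s, ?_⟩
    rw [smul_mul', mul_smul', smul_smul, hε', one_smul, hs]
  · rintro β' hβ ⟨γ, hγ⟩
    have : π • (1 : Ico) = β' * conj β' := by rw [mul_conj, hβ]
    refine ⟨ε • (γ * x + conj β' * y), ?_⟩
    rw [mul_smul', mul_add, ← mul_assoc, ← mul_assoc, ← this, ← hγ, ← hg]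

theorem one_of_nrm {δ : Ico} (h : nrm δ = 1) : δ * conj δ = 1 := by
  rw [mul_conj, h, one_smul]

theorem one_of_nrm' {δ : Ico} (h : nrm δ = 1) : conj δ * δ = 1 := by
  rw [conj_mul, h, one_smul]

theorem card_div {π : O} (hπ : Prime π) (hT : TP π) {α : Ico} (h1 : π ∣ nrm α)
    (h2 : ¬ ∃ α', α = π • α') : Nat.card {β : S π // β.1 ∣ α} = r 1 := by
  obtain ⟨β, hβ, ⟨γ, hγ⟩, hu⟩ := gcd_prime hπ hT h1 h2
  symm
  have hβ0 : β ≠ 0 := by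
    rintro rfl; rw [nrm_eq_zero.2 rfl] at hβ; exact hT.ne_zero hβ.symm
  let f : S 1 → {β : S π // β.1 ∣ α} := fun δ => ⟨⟨β * δ.1, by rw [nrm_mul, hβ, δ.2, mul_one]⟩,
    ⟨conj δ.1 * γ, by rw [mul_assoc, ← mul_assoc δ.1, one_of_nrm δ.2, one_mul, hγ]⟩⟩
  refine Nat.card_eq_of_bijective f ⟨?_, ?_⟩
  · intro x y h
    have : β * x.1 = β * y.1 := congrArg (fun z => z.1.1) h
    exact Subtype.ext (mul_left_cancel₀ hβ0 this)
  · rintro ⟨⟨β', hb⟩, hd⟩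
    obtain ⟨δ, hδ⟩ := hu β' hb hd
    have hn : nrm δ = 1 := by
      have := congrArg nrm hδ
      rw [nrm_mul, hβ, hb] at this
      exact (mul_left_cancel₀ hT.ne_zero (by rw [← this, mul_one]) : nrm δ = 1)
    refine ⟨⟨conj δ, by rw [nrm_conj, hn]⟩, ?_⟩
    apply Subtype.ext
    apply Subtype.ext
    change β * conj δ = β'
    rw [hδ, mul_assoc, one_of_nrm hn, mul_one]

/-- pairs -/
theorem count_pairs {π : O} (hπ : Prime π) (hT : TP π) (m : O) :
    r π * r m + r 1 * Nat.card {x : Ico // π * nrm x = m} =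
      r 1 * r (π * m) + r π * Nat.card {x : Ico // π * nrm x = m} := by
  classical
  have e0 : S π × S m ≃ Σ α : S (π * m), {β : S π // β.1 ∣ α.1} := by
    refine Equiv.ofBijective (fun p => ⟨⟨p.1.1 * p.2.1, by rw [nrm_mul, p.1.2, p.2.2]⟩, ⟨p.1, Dvd.intro _ rfl⟩⟩)
      ⟨?_, ?_⟩
    · rintro ⟨⟨a, ha⟩, ⟨b, hb⟩⟩ ⟨⟨a', ha'⟩, ⟨b', hb'⟩⟩ h
      have h1 := congrArg (fun z => z.1.1) h
      have h2 := congrArg (fun z => z.2.1.1) h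
      simp only at h1 h2
      subst h2
      have ha0 : a ≠ 0 := by
        rintro rfl; rw [nrm_eq_zero.2 rfl] at ha; exact hT.ne_zero ha.symm
      have := mul_left_cancel₀ ha0 h1
      subst this
      rfl
    · rintro ⟨⟨α, hα⟩, ⟨⟨β, hβ⟩, ⟨γ, hγ⟩⟩⟩
      simp only at hγ
      subst hγ
      have : nrm γ = m := by
        rw [nrm_mul, hβ] at hα
        exact mul_left_cancel₀ hT.ne_zero hα
      exact ⟨(⟨β, hβ⟩, ⟨γ, this⟩), rfl⟩
  have : Fintype (S (π * m)) := Fintype.ofFinite _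
  have h0 : r π * r m = ∑ α : S (π * m), Nat.card {β : S π // β.1 ∣ α.1} := by
    rw [r, r, ← Nat.card_prod, Nat.card_congr e0, Nat.card_sigma]
  have h1 : ∀ α : S (π * m), Nat.card {β : S π // β.1 ∣ α.1} + (if ∃ α', α.1 = π • α' then r 1 else 0) =
      r 1 + (if ∃ α', α.1 = π • α' then r π else 0) := by
    intro α
    split_ifs with h
    · rw [add_comm]
      congr 1
      refine Nat.card_congr (Equiv.subtypeUnivEquiv ?_)
      rintro ⟨β, hβ⟩
      obtain ⟨α', h⟩ := h
      refine ⟨conj β * α', ?_⟩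
      rw [h, ← mul_assoc, mul_conj, hβ, smul_mul', one_mul]
    · rw [card_div hπ hT (by rw [α.2]; exact Dvd.intro _ rfl) h]
  have h2 : (Finset.univ.filter (fun α : S (π * m) => ∃ α', α.1 = π • α')).card =
      Nat.card {x : Ico // π * nrm x = m} := by
    rw [← Fintype.card_subtype, ← Nat.card_eq_fintype_card]
    symm
    refine Nat.card_eq_of_bijective (fun x => ⟨⟨π • x.1, by
      rw [nrm_smul]; linear_combination π * x.2⟩, ⟨x.1, rfl⟩⟩) ⟨?_, ?_⟩
    · intro x y h
      have h : π • x.1 = π • y.1 := congrArg (fun z => z.1.1) h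
      apply Subtype.ext
      have h3 : nrm (x.1 - y.1) = 0 := by
        have : nrm (π • (x.1 - y.1)) = 0 := by rw [smul_sub, h, sub_self, nrm_eq_zero]
        rw [nrm_smul] at this
        exact (mul_eq_zero.1 this).resolve_left (pow_ne_zero _ hT.ne_zero)
      exact sub_eq_zero.1 (nrm_eq_zero.1 h3)
    · rintro ⟨⟨α, hα⟩, ⟨α', h⟩⟩
      simp only at h
      subst h
      refine ⟨⟨α', ?_⟩, rfl⟩
      rw [nrm_smul] at hα
      apply mul_left_cancel₀ hT.ne_zero
      rw [← hα]; ring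
  have h3 := Finset.sum_congr rfl (fun α (_ : α ∈ Finset.univ) => h1 α)
  rw [Finset.sum_add_distrib, Finset.sum_add_distrib, ← h0, ← Finset.sum_filter, ← Finset.sum_filter,
    Finset.sum_const, Finset.sum_const, Finset.sum_const, h2, Finset.card_univ, ← Nat.card_eq_fintype_card] at h3
  simp only [smul_eq_mul] at h3
  change _ = r (π * m) * r 1 + _ at h3
  linarith
end Ico
end FS5

namespace FS5
open QuadraticAlgebra

section mat
variable {F : Type*} [Field F]

/-- representatives of the projective line -/
def Wv : Option F → (Fin 2 → F)
  | none => ![0, 1]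
  | some t => ![1, t]

/-- matrices with given left kernel -/
def Av : Option F → Matrix (Fin 2) (Fin 2) F
  | none => !![1, 0; 0, 0]
  | some t => !![-t, 0; 1, 0]

open Matrix

theorem Av_ne (p : Option F) : Av p ≠ 0 := by
  cases p with
  | none => intro h; have := congrFun₂ h 0 0; simp [Av] at this
  | some t => intro h; have := congrFun₂ h 1 0; simp [Av] at this

theorem Av_det (p : Option F) : (Av p).det = 0 := by
  cases p <;> simp [Av, Matrix.det_fin_two]

theorem WA (p : Option F) : Wv p ᵥ* Av p = 0 := by
  cases p <;> ext i <;> fin_cases i <;> simp [Av, Wv, Matrix.vecMul, dotProduct, Fin.sum_univ_two]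

theorem W_iff_none (B : Matrix (Fin 2) (Fin 2) F) : Wv none ᵥ* B = 0 ↔ B 1 0 = 0 ∧ B 1 1 = 0 := by
  rw [funext_iff, Fin.forall_fin_two]
  simp [Wv, Matrix.vecMul, dotProduct, Fin.sum_univ_two]

theorem W_iff_some (t : F) (B : Matrix (Fin 2) (Fin 2) F) : Wv (some t) ᵥ* B = 0 ↔
    B 0 0 = - t * B 1 0 ∧ B 0 1 = - t * B 1 1 := by
  rw [funext_iff, Fin.forall_fin_two]
  simp [Wv, Matrix.vecMul, dotProduct, Fin.sum_univ_two, eq_neg_iff_add_eq_zero]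

theorem mat_zero {B : Matrix (Fin 2) (Fin 2) F} (h1 : B 0 0 = 0) (h2 : B 0 1 = 0) (h3 : B 1 0 = 0)
    (h4 : B 1 1 = 0) : B = 0 := by
  ext i j; fin_cases i <;> fin_cases j <;> simpa

theorem W_uniq {B : Matrix (Fin 2) (Fin 2) F} (hB : B ≠ 0) {p p' : Option F} (h : Wv p ᵥ* B = 0)
    (h' : Wv p' ᵥ* B = 0) : p = p' := by
  by_contra hne
  apply hB
  cases p with
  | none =>
    cases p' with
    | none => exact absurd rfl hne
    | some t =>
      rw [W_iff_none] at h
      rw [W_iff_some, h.1, h.2] at h'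
      exact mat_zero (by simpa using h'.1) (by simpa using h'.2) h.1 h.2
  | some s =>
    cases p' with
    | none =>
      rw [W_iff_none] at h'
      rw [W_iff_some, h'.1, h'.2] at h
      exact mat_zero (by simpa using h.1) (by simpa using h.2) h'.1 h'.2
    | some t =>
      rw [W_iff_some] at h h'
      have hst : t - s ≠ 0 := fun h0 => hne (by rw [sub_eq_zero.1 h0])
      have a1 : B 1 0 = 0 := by
        have : (t - s) * B 1 0 = 0 := by linear_combination h'.1 - h.1
        exact (mul_eq_zero.1 this).resolve_left hst
      have a2 : B 1 1 = 0 := by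
        have : (t - s) * B 1 1 = 0 := by linear_combination h'.2 - h.2
        exact (mul_eq_zero.1 this).resolve_left hst
      exact mat_zero (by rw [h.1, a1]; simp) (by rw [h.2, a2]; simp) a1 a2

theorem W_exists {B : Matrix (Fin 2) (Fin 2) F} (hB : B.det = 0) : ∃ p, Wv p ᵥ* B = 0 := by
  rw [Matrix.det_fin_two] at hB
  by_cases h1 : B 1 0 = 0
  · by_cases h2 : B 1 1 = 0
    · exact ⟨none, (W_iff_none _).2 ⟨h1, h2⟩⟩
    · refine ⟨some (-(B 0 1) / B 1 1), (W_iff_some _ _).2 ⟨?_, ?_⟩⟩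
      · field_simp; linear_combination hB
      · field_simp
  · refine ⟨some (-(B 0 0) / B 1 0), (W_iff_some _ _).2 ⟨?_, ?_⟩⟩
    · field_simp
    · field_simp; linear_combination -hB

theorem W_factor {B : Matrix (Fin 2) (Fin 2) F} (hB : B ≠ 0) {p : Option F} (h : Wv p ᵥ* B = 0) :
    ∃ C, Av p = B * C := by
  have aux : ∀ x y : F, (x ≠ 0 ∨ y ≠ 0) → ∃ c d : F, x * c + y * d = 1 := by
    rintro x y (h | h)
    · exact ⟨x⁻¹, 0, by field_simp; simp⟩
    · exact ⟨0, y⁻¹, by field_simp; simp⟩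
  cases p with
  | none =>
    rw [W_iff_none] at h
    obtain ⟨c, d, hcd⟩ := aux (B 0 0) (B 0 1) (by
      by_contra hc; push Not at hc
      exact hB (mat_zero hc.1 hc.2 h.1 h.2))
    refine ⟨!![c, 0; d, 0], ?_⟩
    ext i j; fin_cases i <;> fin_cases j <;> simp [Av, Matrix.mul_apply, Fin.sum_univ_two, h, hcd]
  | some t =>
    rw [W_iff_some] at h
    obtain ⟨c, d, hcd⟩ := aux (B 1 0) (B 1 1) (by
      by_contra hc; push Not at hc
      exact hB (mat_zero (by rw [h.1, hc.1, mul_zero]) (by rw [h.2, hc.2, mul_zero]) hc.1 hc.2))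
    refine ⟨!![c, 0; d, 0], ?_⟩
    ext i j; fin_cases i <;> fin_cases j <;> simp [Av, Matrix.mul_apply, Fin.sum_univ_two, h, hcd]
    linear_combination t * hcd

end mat

theorem two_H (h : H) : (2 : O) • h ∈ J := by
  rw [mem_J_iff]
  refine ⟨?_, ?_, ?_, ?_⟩ <;> simp <;> omega

namespace Ico
open Matrix

section
variable {F : Type*} [Field F] (f : O →+* F) (a b : F)

/-- splitting of the quaternions -/
def Mm (y : H) : Matrix (Fin 2) (Fin 2) F :=
  !![f y.re + a * f y.imI + b * f y.imK, b * f y.imI - f y.imJ - a * f y.imK;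
     b * f y.imI + f y.imJ - a * f y.imK, f y.re - a * f y.imI - b * f y.imK]

theorem Mm_mul (hab : a ^ 2 + b ^ 2 = -1) (x y : H) : Mm f a b (x * y) = Mm f a b x * Mm f a b y := by
  ext i j
  fin_cases i <;> fin_cases j <;> simp [Mm, Matrix.mul_apply, Fin.sum_univ_two]
  · linear_combination (-(f x.imI * f y.imI + f x.imK * f y.imK)) * hab
  · linear_combination (-(f x.imK * f y.imI - f x.imI * f y.imK)) * hab
  · linear_combination (-(f x.imI * f y.imK - f x.imK * f y.imI)) * hab
  · linear_combination (-(f x.imI * f y.imI + f x.imK * f y.imK)) * hab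

theorem Mm_smul (c : O) (x : H) : Mm f a b (c • x) = f c • Mm f a b x := by
  ext i j
  fin_cases i <;> fin_cases j <;> simp [Mm] <;> ring

theorem Mm_sub (x y : H) : Mm f a b (x - y) = Mm f a b x - Mm f a b y := by
  ext i j
  fin_cases i <;> fin_cases j <;> simp [Mm] <;> ring

theorem Mm_det (hab : a ^ 2 + b ^ 2 = -1) (x : H) : (Mm f a b x).det = f (nsq x) := by
  rw [Matrix.det_fin_two]
  simp [Mm, nsq]
  linear_combination (-(f x.imI) ^ 2 - (f x.imK) ^ 2) * hab

end

theorem exists_T {π : O} (hπ : Prime π) (h2 : ¬ π ∣ 2) {F : Type} [Field F] [Finite F] (f : O →+* F)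
    (hf : Function.Surjective f) (hk : ∀ x, f x = 0 ↔ π ∣ x) :
    ∃ T : Ico → Matrix (Fin 2) (Fin 2) F, (∀ x y, T (x * y) = T x * T y) ∧
      (∀ x y, T (x - y) = T x - T y) ∧ Function.Surjective T ∧ (∀ x, T x = 0 ↔ ∃ x', x = π • x') ∧
      (∀ x, (T x).det = f (nrm x)) := by
  have h2' : (2 : F) ≠ 0 := by
    intro h; apply h2; rw [← hk, map_ofNat, h]
  obtain ⟨a, b, hab⟩ : ∃ a b : F, a ^ 2 + b ^ 2 = -1 := by
    have := Fintype.ofFinite F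
    obtain ⟨p, hp⟩ := CharP.exists F
    have : Fact p.Prime := ⟨CharP.char_is_prime F p⟩
    obtain ⟨a, b, h⟩ := CharP.sq_add_sq F p (-1)
    exact ⟨a, b, by simpa using h⟩
  have hcop : ∃ u w : O, u * π + w * 2 = 1 :=
    (hπ.irreducible.coprime_iff_not_dvd.2 h2)
  obtain ⟨u, w, huw⟩ := hcop
  refine ⟨fun x => (2 : F)⁻¹ • Mm f a b (v x), ?_, ?_, ?_, ?_, ?_⟩
  · intro x y
    have := congrArg (Mm f a b) (two_v_mul x y)
    rw [Mm_mul f a b hab, Mm_smul, map_ofNat] at this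
    rw [smul_mul_smul_comm, ← this, smul_smul]
    congr 1
    field_simp
  · intro x y
    beta_reduce
    rw [map_sub, Mm_sub, smul_sub]
  · intro B
    obtain ⟨x0, h0⟩ := hf ((B 0 0 + B 1 1) / 2)
    obtain ⟨x1, h1⟩ := hf (-(a * ((B 0 0 - B 1 1) / 2) + b * ((B 0 1 + B 1 0) / 2)))
    obtain ⟨x2, h2⟩ := hf ((B 1 0 - B 0 1) / 2)
    obtain ⟨x3, h3⟩ := hf (-(b * ((B 0 0 - B 1 1) / 2) - a * ((B 0 1 + B 1 0) / 2)))
    refine ⟨mk _ (two_H ⟨x0, x1, x2, x3⟩), ?_⟩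
    simp only [v_mk]
    rw [Mm_smul, map_ofNat, smul_smul, inv_mul_cancel₀ h2', one_smul]
    ext i j
    fin_cases i <;> fin_cases j <;> simp [Mm, h0, h1, h2, h3] <;> field_simp
    · linear_combination -(B 0 0 - B 1 1) * hab
    · linear_combination -(B 0 1 + B 1 0) * hab
    · linear_combination -(B 0 1 + B 1 0) * hab
    · linear_combination (B 0 0 - B 1 1) * hab
  · intro x
    constructor
    · intro h
      have hM : Mm f a b (v x) = 0 := by
        rcases smul_eq_zero.1 h with h | h
        · exact absurd h (inv_ne_zero h2')
        · exact h
      have c00 := congrFun₂ hM 0 0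
      have c01 := congrFun₂ hM 0 1
      have c10 := congrFun₂ hM 1 0
      have c11 := congrFun₂ hM 1 1
      simp [Mm] at c00 c01 c10 c11
      have z : ∀ t : F, 2 * t = 0 → t = 0 := fun t ht => (mul_eq_zero.1 ht).resolve_left h2'
      obtain ⟨y0, d0⟩ := (hk _).1 (z _ (by linear_combination c00 + c11) : f (v x).re = 0)
      obtain ⟨y1, d1⟩ := (hk _).1 (z _ (by linear_combination (2 * f (v x).imI) * hab - a * (c00 - c11) - b * (c01 + c10)) : f (v x).imI = 0)
      obtain ⟨y2, d2⟩ := (hk _).1 (z _ (by linear_combination c10 - c01) : f (v x).imJ = 0)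
      obtain ⟨y3, d3⟩ := (hk _).1 (z _ (by linear_combination (2 * f (v x).imK) * hab - b * (c00 - c11) + a * (c01 + c10)) : f (v x).imK = 0)
      have e : v x = π • (⟨y0, y1, y2, y3⟩ : H) := by
        ext1 <;> simp [d0, d1, d2, d3]
      have hm : (⟨y0, y1, y2, y3⟩ : H) ∈ J := by
        have : (⟨y0, y1, y2, y3⟩ : H) = u • v x + w • (2 : O) • (⟨y0, y1, y2, y3⟩ : H) := by
          rw [e, smul_smul, smul_smul, ← add_smul, huw, one_smul]
        rw [this]
        exact J.add_mem (J.smul_mem _ (v_mem x)) (J.smul_mem _ (two_H _))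
      exact ⟨mk _ hm, v_inj (by rw [e, map_smul, v_mk])⟩
    · rintro ⟨x', rfl⟩
      beta_reduce
      rw [map_smul, Mm_smul, (hk π).2 dvd_rfl, zero_smul, smul_zero]
  · intro x
    rw [Matrix.det_smul, Mm_det f a b hab, ← four_nrm, map_mul, map_ofNat, Fintype.card_fin]
    field_simp
    norm_num

theorem not_smul_of_nrm {π : O} (hπ : Prime π) {β : Ico} (h : nrm β = π) : ¬ ∃ α', β = π • α' := by
  rintro ⟨α', rfl⟩
  rw [nrm_smul] at h
  apply hπ.not_isUnit
  refine IsUnit.of_mul_eq_one (nrm α') ?_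
  apply mul_left_cancel₀ hπ.ne_zero
  linear_combination h

theorem r_prime {π : O} (hπ : Prime π) (hT : TP π) (h2 : ¬ π ∣ 2) {F : Type} [Field F] [Finite F] (f : O →+* F)
    (hf : Function.Surjective f) (hk : ∀ x, f x = 0 ↔ π ∣ x) : r π = r 1 * (Nat.card F + 1) := by
  obtain ⟨T, Tm, Ts, Tsurj, Tk, Td⟩ := exists_T hπ h2 f hf hk
  have hne : ∀ β : S π, T β.1 ≠ 0 := fun β => by
    rw [Ne, Tk]; exact not_smul_of_nrm hπ β.2
  have hdet : ∀ β : S π, (T β.1).det = 0 := fun β => by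
    rw [Td, β.2, hk]
  choose p hp using fun β : S π => W_exists (hdet β)
  have hfib : ∀ q : Option F, Nat.card {β : S π // p β = q} = r 1 := by
    intro q
    obtain ⟨α, hα⟩ := Tsurj (Av q)
    have h1 : π ∣ nrm α := by rw [← hk, ← Td, hα, Av_det]
    have h3 : ¬ ∃ α', α = π • α' := by rw [← Tk, hα]; exact Av_ne q
    rw [← card_div hπ hT h1 h3]
    refine Nat.card_congr (Equiv.subtypeEquivRight fun β => ?_)
    constructor
    · intro h
      have := hp β
      rw [h] at this
      obtain ⟨C, hC⟩ := W_factor (hne β) this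
      obtain ⟨γ, hγ⟩ := Tsurj C
      have h0 : T (α - β.1 * γ) = 0 := by rw [Ts, Tm, hα, hγ, hC, sub_self]
      obtain ⟨z, hz⟩ := (Tk _).1 h0
      refine ⟨γ + conj β.1 * z, ?_⟩
      rw [mul_add, ← mul_assoc, mul_conj, β.2, smul_mul', one_mul, ← hz]
      abel
    · rintro ⟨γ, hγ⟩
      have h4 : Wv (p β) ᵥ* Av q = 0 := by
        rw [← hα, hγ, Tm, ← Matrix.vecMul_vecMul, hp β, Matrix.zero_vecMul]
      exact W_uniq (Av_ne q) h4 (WA q)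
  have := Fintype.ofFinite F
  rw [r, ← Nat.card_congr (Equiv.sigmaFiberEquiv p), Nat.card_sigma]
  simp only [hfib]
  rw [Finset.sum_const, Finset.card_univ, Fintype.card_option, ← Nat.card_eq_fintype_card, smul_eq_mul, mul_comm]

end Ico
end FS5

namespace FS5
open QuadraticAlgebra
namespace Ico

/-- integer coordinates -/
def co (l : Fin 8) (y : H) : ℤ := ![y.re.re, y.re.im, y.imI.re, y.imI.im, y.imJ.re, y.imJ.im, y.imK.re, y.imK.im] l

theorem co_ext {y z : H} (h : ∀ l, co l y = co l z) : y = z := by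
  ext1 <;> ext
  exacts [h 0, h 1, h 2, h 3, h 4, h 5, h 6, h 7]

theorem co_add (l : Fin 8) (y z : H) : co l (y + z) = co l y + co l z := by
  fin_cases l <;> simp [co]

theorem co_zero (l : Fin 8) : co l 0 = 0 := by
  fin_cases l <;> simp [co]

theorem co_zsmul (l : Fin 8) (n : ℤ) (y : H) : co l (n • y) = n * co l y := by
  fin_cases l <;> simp [co]

theorem co_two (l : Fin 8) (y : H) : co l ((2 : O) • y) = 2 * co l y := by
  fin_cases l <;> simp [co]

theorem co_sum {ι : Type*} (s : Finset ι) (f : ι → H) (l : Fin 8) : co l (∑ i ∈ s, f i) = ∑ i ∈ s, co l (f i) := by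
  classical
  induction s using Finset.induction_on with
  | empty => simp [co_zero]
  | insert a s ha ih => rw [Finset.sum_insert ha, Finset.sum_insert ha, co_add, ih]

/-- Divisibility by two of all coordinates: `x` lies in the Lipschitz order. -/
def L (x : Ico) : Prop := ∀ l, 2 ∣ co l (v x)

def ZB : Fin 8 → H := ![⟨⟨1, 0⟩, ⟨1, 0⟩, ⟨1, 0⟩, ⟨1, 0⟩⟩,
  ⟨⟨0, 1⟩, ⟨0, 1⟩, ⟨0, 1⟩, ⟨0, 1⟩⟩,
  ⟨⟨0, 0⟩, ⟨1, 0⟩, ⟨1, 1⟩, ⟨0, 1⟩⟩,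
  ⟨⟨0, 0⟩, ⟨0, 1⟩, ⟨1, 2⟩, ⟨1, 1⟩⟩,
  ⟨⟨0, 0⟩, ⟨0, 0⟩, ⟨2, 0⟩, ⟨0, 0⟩⟩,
  ⟨⟨0, 0⟩, ⟨0, 0⟩, ⟨0, 2⟩, ⟨0, 0⟩⟩,
  ⟨⟨0, 0⟩, ⟨0, 0⟩, ⟨0, 0⟩, ⟨2, 0⟩⟩,
  ⟨⟨0, 0⟩, ⟨0, 0⟩, ⟨0, 0⟩, ⟨0, 2⟩⟩]

theorem ZB_par : ∀ k, par (ZB k) := by decide +kernel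

theorem exists_coord (c : Ico) : ∃ x : Fin 8 → ℤ, v c = ∑ k, x k • ZB k := by
  obtain ⟨⟨k1, h1⟩, ⟨k2, h2⟩, ⟨k3, h3⟩, ⟨k4, h4⟩⟩ := (mem_J_iff _).1 (v_mem c)
  obtain ⟨u, w, h1, h2⟩ := v_mem c
  refine ⟨![(v c).re.re, (v c).re.im, ((v c).imI - (v c).re).re, ((v c).imI - (v c).re).im, u.re, u.im, w.re, w.im], ?_⟩
  rw [Fin.sum_univ_eight]
  have a1 := congrArg QuadraticAlgebra.re h1
  have a2 := congrArg QuadraticAlgebra.im h1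
  have a3 := congrArg QuadraticAlgebra.re h2
  have a4 := congrArg QuadraticAlgebra.im h2
  simp [ph, QuadraticAlgebra.re_one, QuadraticAlgebra.im_one] at a1 a2 a3 a4
  ext1 <;> ext <;> simp [ZB] <;> linarith

/-- coset representatives -/
def un : Fin 15 → H := ![⟨⟨2, 0⟩, ⟨0, 0⟩, ⟨0, 0⟩, ⟨0, 0⟩⟩, ⟨⟨-1, 1⟩, ⟨-1, 0⟩, ⟨0, -1⟩, ⟨0, 0⟩⟩,
  ⟨⟨0, -1⟩, ⟨1, -1⟩, ⟨-1, 0⟩, ⟨0, 0⟩⟩,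
  ⟨⟨0, -1⟩, ⟨-1, 1⟩, ⟨1, 0⟩, ⟨0, 0⟩⟩, ⟨⟨-1, 1⟩, ⟨1, 0⟩, ⟨0, 1⟩, ⟨0, 0⟩⟩, ⟨⟨-1, 0⟩, ⟨-1, 0⟩, ⟨-1, 0⟩, ⟨-1, 0⟩⟩,
  ⟨⟨0, -1⟩, ⟨1, 0⟩, ⟨0, 0⟩, ⟨1, -1⟩⟩, ⟨⟨0, 0⟩, ⟨0, 1⟩, ⟨1, 0⟩, ⟨-1, 1⟩⟩, ⟨⟨0, 1⟩, ⟨0, 0⟩, ⟨-1, 1⟩, ⟨1, 0⟩⟩,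
  ⟨⟨1, 0⟩, ⟨0, -1⟩, ⟨1, -1⟩, ⟨0, 0⟩⟩, ⟨⟨-1, 0⟩, ⟨1, 0⟩, ⟨1, 0⟩, ⟨1, 0⟩⟩, ⟨⟨1, 0⟩, ⟨0, 0⟩, ⟨0, 1⟩, ⟨-1, 1⟩⟩,
  ⟨⟨0, 1⟩, ⟨-1, 0⟩, ⟨0, 0⟩, ⟨1, -1⟩⟩, ⟨⟨0, 0⟩, ⟨1, -1⟩, ⟨0, -1⟩, ⟨-1, 0⟩⟩, ⟨⟨0, -1⟩, ⟨-1, 1⟩, ⟨-1, 0⟩, ⟨0, 0⟩⟩]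

def up (i : Fin 5) : H := un (Fin.castLE (by norm_num) i)

theorem un_par : ∀ i, par (un i) ∧ nsq (un i) = 4 := by decide +kernel

noncomputable def hu (i : Fin 15) : Ico := mk (un i) ((mem_J_iff _).2 (un_par i).1)
theorem nrm_hu (i : Fin 15) : nrm (hu i) = 1 := by
  apply mul_left_cancel₀ four_ne
  rw [four_nrm, hu, v_mk, (un_par i).2, mul_one]
noncomputable def hp (i : Fin 5) : Ico := hu (Fin.castLE (by norm_num) i)
theorem nrm_hp (i : Fin 5) : nrm (hp i) = 1 := nrm_hu _
theorem v_hu (i : Fin 15) : v (hu i) = un i := rfl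
theorem v_hp (i : Fin 5) : v (hp i) = up i := rfl

def tabA : Fin 15 → Fin 8 → ℕ := ![![85, 170, 180, 216, 0, 0, 0, 0],
  ![30, 39, 75, 141, 114, 147, 216, 108],
  ![108, 180, 114, 147, 225, 114, 180, 216],
  ![198, 75, 170, 255, 225, 114, 180, 216],
  ![225, 114, 39, 57, 114, 147, 216, 108],
  ![85, 170, 39, 57, 85, 170, 85, 170],
  ![141, 198, 216, 108, 108, 180, 147, 225],
  ![30, 39, 147, 225, 141, 198, 39, 57],
  ![180, 216, 170, 255, 39, 57, 141, 198],
  ![114, 147, 198, 75, 147, 225, 108, 180],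
  ![0, 0, 147, 225, 85, 170, 85, 170],
  ![147, 225, 147, 225, 30, 39, 75, 141],
  ![114, 147, 225, 114, 108, 180, 147, 225],
  ![114, 147, 0, 0, 198, 75, 57, 30],
  ![147, 225, 225, 114, 225, 114, 180, 216]]

def tabB : Fin 5 → Fin 5 → Fin 8 → ℕ := ![![![85, 170, 180, 216, 0, 0, 0, 0],
  ![30, 39, 75, 141, 114, 147, 216, 108],
  ![108, 180, 114, 147, 225, 114, 180, 216],
  ![198, 75, 170, 255, 225, 114, 180, 216],
  ![225, 114, 39, 57, 114, 147, 216, 108]],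
  ![![198, 75, 39, 57, 114, 147, 216, 108],
  ![108, 180, 170, 255, 57, 30, 0, 0],
  ![30, 39, 114, 147, 85, 170, 216, 108],
  ![85, 170, 75, 141, 198, 75, 180, 216],
  ![225, 114, 180, 216, 216, 108, 180, 216]],
  ![![216, 108, 170, 255, 225, 114, 180, 216],
  ![198, 75, 30, 39, 85, 170, 216, 108],
  ![85, 170, 147, 225, 30, 39, 0, 0],
  ![57, 30, 108, 180, 108, 180, 216, 108],
  ![114, 147, 75, 141, 198, 75, 180, 216]],
  ![![114, 147, 114, 147, 225, 114, 180, 216],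
  ![225, 114, 147, 225, 198, 75, 180, 216],
  ![225, 114, 0, 0, 108, 180, 216, 108],
  ![114, 147, 147, 225, 30, 39, 0, 0],
  ![0, 0, 114, 147, 85, 170, 216, 108]],
  ![![57, 30, 75, 141, 114, 147, 216, 108],
  ![85, 170, 108, 180, 216, 108, 180, 216],
  ![198, 75, 147, 225, 198, 75, 180, 216],
  ![216, 108, 30, 39, 85, 170, 216, 108],
  ![114, 147, 170, 255, 57, 30, 0, 0]]]

/-- linear combination with bit coefficients, over the field with two elements -/
def xs (b : Fin 8 → Bool) (c : Fin 8 → ℕ) : ℕ :=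
  (bif b 0 then c 0 else 0) ^^^ (bif b 1 then c 1 else 0) ^^^ (bif b 2 then c 2 else 0) ^^^
  (bif b 3 then c 3 else 0) ^^^ (bif b 4 then c 4 else 0) ^^^ (bif b 5 then c 5 else 0) ^^^
  (bif b 6 then c 6 else 0) ^^^ (bif b 7 then c 7 else 0)

/-- parity bit -/
def bit (a : ℤ) : Bool := decide (a % 2 = 1)

theorem bit_add (a b : ℤ) : bit (a + b) = (bit a ^^ bit b) := by
  rcases Int.emod_two_eq_zero_or_one a with h | h <;> rcases Int.emod_two_eq_zero_or_one b with h' | h' <;>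
    simp [bit, Int.add_emod, h, h']

theorem bit_mul (a b : ℤ) : bit (a * b) = (bit a && bit b) := by
  rcases Int.emod_two_eq_zero_or_one a with h | h <;> rcases Int.emod_two_eq_zero_or_one b with h' | h' <;>
    simp [bit, Int.mul_emod, h, h']

theorem bit_false (a : ℤ) : bit a = false ↔ 2 ∣ a := by
  simp only [bit, decide_eq_false_iff_not]; omega

theorem testBit_cond (b : Bool) (n l : ℕ) : (bif b then n else 0).testBit l = (b && n.testBit l) := by
  cases b <;> simp

theorem xs_testBit (b : Fin 8 → Bool) (c : Fin 8 → ℕ) (l : ℕ) : (xs b c).testBit l =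
   ((b 0 && (c 0).testBit l) ^^ (b 1 && (c 1).testBit l) ^^ (b 2 && (c 2).testBit l) ^^ (b 3 && (c 3).testBit l)
   ^^ (b 4 && (c 4).testBit l) ^^ (b 5 && (c 5).testBit l) ^^ (b 6 && (c 6).testBit l) ^^ (b 7 && (c 7).testBit l)) := by
  simp only [xs, Nat.testBit_xor, testBit_cond]

theorem xs_zero (t : Fin 8 → Fin 8 → ℤ) (c : Fin 8 → ℕ)
    (hc : ∀ k l : Fin 8, (c k).testBit l = bit (t k l)) (hlt : ∀ k, c k < 256) (x : Fin 8 → ℤ) :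
    (∀ l, 2 ∣ ∑ k, x k * t k l) ↔ xs (fun k => bit (x k)) c = 0 := by
  have h1 : ∀ l : Fin 8, 2 ∣ ∑ k, x k * t k l ↔ (xs (fun k => bit (x k)) c).testBit l = false := by
    intro l
    rw [← bit_false, Fin.sum_univ_eight, xs_testBit]
    simp only [bit_add, bit_mul, hc]
  constructor
  · intro h
    apply Nat.eq_of_testBit_eq
    intro i
    rw [Nat.zero_testBit]
    by_cases hi : i < 8
    · exact (h1 ⟨i, hi⟩).1 (h _)
    · rw [xs_testBit]
      have : ∀ k, (c k).testBit i = false := fun k => Nat.testBit_lt_two_pow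
        (lt_of_lt_of_le (hlt k) (by rw [show 256 = 2 ^ 8 from rfl]; exact Nat.pow_le_pow_right (by norm_num) (by omega)))
      simp [this]
  · intro h l
    rw [h1, h, Nat.zero_testBit]

def TA (j : Fin 15) (k : Fin 8) : H := half (ZB k * un j)
def TB (i j : Fin 5) (k : Fin 8) : H := half (half (up i * ZB k * up j))

theorem tabA_lt : ∀ j k, tabA j k < 256 := by decide +kernel
theorem tabB_lt : ∀ i j k, tabB i j k < 256 := by decide +kernel

theorem TA_eq : ∀ j k, ZB k * un j = (2 : O) • TA j k := by decide +kernel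
theorem TB_eq : ∀ i j k, up i * ZB k * up j = (2 : O) • (2 : O) • TB i j k := by decide +kernel
theorem tabA_eq : ∀ j k l, (tabA j k).testBit (l : Fin 8) = bit (co l (TA j k)) := by decide +kernel
theorem tabB_eq : ∀ i j k l, (tabB i j k).testBit (l : Fin 8) = bit (co l (TB i j k)) := by decide +kernel

/-- representative of a class modulo two -/
def yb (b : Fin 8 → Bool) : H := ∑ k, (bif b k then 1 else 0 : ℤ) • ZB k

def E8 (x : O) : Prop := 8 ∣ x.re ∧ 8 ∣ x.im
instance (x : O) : Decidable (E8 x) := by unfold E8; infer_instance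

theorem checkA : ∀ b0 b1 b2 b3 b4 b5 b6 b7 : Bool, ¬ E8 (nsq (yb ![b0, b1, b2, b3, b4, b5, b6, b7])) →
    ∃ i, ∀ j, xs ![b0, b1, b2, b3, b4, b5, b6, b7] (tabA j) = 0 ↔ j = i := by
  decide +kernel

theorem checkB : ∀ b0 b1 b2 b3 b4 b5 b6 b7 : Bool, (b0 || b1 || b2 || b3 || b4 || b5 || b6 || b7) = true →
    E8 (nsq (yb ![b0, b1, b2, b3, b4, b5, b6, b7])) →
    ∃ i, ∀ j : Fin 5 × Fin 5, xs ![b0, b1, b2, b3, b4, b5, b6, b7] (tabB j.1 j.2) = 0 ↔ j = i := by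
  decide +kernel

end Ico
end FS5

namespace FS5
open QuadraticAlgebra
namespace Ico

theorem zsmul_mul_right (n : ℤ) (x y : H) : (n • x) * y = n • (x * y) := smul_mul_assoc n x y

theorem two_inj4 {a b : H} (h : (2 : O) • (2 : O) • a = (2 : O) • (2 : O) • b) : a = b :=
  two_smul_inj (two_smul_inj h)

theorem L_A (c : Ico) (x : Fin 8 → ℤ) (hx : v c = ∑ k, x k • ZB k) (j : Fin 15) :
    L (c * hu j) ↔ xs (fun k => bit (x k)) (tabA j) = 0 := by
  have h : v (c * hu j) = ∑ k, x k • TA j k := by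
    apply two_smul_inj
    rw [two_v_mul, hx, v_hu, Finset.sum_mul, Finset.smul_sum]
    refine Finset.sum_congr rfl fun k _ => ?_
    rw [smul_mul_assoc, TA_eq, smul_comm]
  rw [← xs_zero (fun k l => co l (TA j k)) _ (fun k l => tabA_eq j k l) (tabA_lt j)]
  simp only [L, h, co_sum, co_zsmul]

theorem L_B (c : Ico) (x : Fin 8 → ℤ) (hx : v c = ∑ k, x k • ZB k) (i j : Fin 5) :
    L (hp i * c * hp j) ↔ xs (fun k => bit (x k)) (tabB i j) = 0 := by
  have h : v (hp i * c * hp j) = ∑ k, x k • TB i j k := by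
    apply two_inj4
    rw [two_v_mul, ← smul_mul_assoc, two_v_mul, hx, v_hp, v_hp, Finset.mul_sum, Finset.sum_mul,
      Finset.smul_sum, Finset.smul_sum]
    refine Finset.sum_congr rfl fun k _ => ?_
    rw [mul_smul_comm, smul_mul_assoc, TB_eq, smul_comm (x k), smul_comm (x k)]
  rw [← xs_zero (fun k l => co l (TB i j k)) _ (fun k l => tabB_eq i j k l) (tabB_lt i j)]
  simp only [L, h, co_sum, co_zsmul]

theorem vec8 (b : Fin 8 → Bool) : b = ![b 0, b 1, b 2, b 3, b 4, b 5, b 6, b 7] := by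
  funext k; fin_cases k <;> rfl

theorem split_bits (c : Ico) (x : Fin 8 → ℤ) (hx : v c = ∑ k, x k • ZB k) :
    ∃ w ∈ J, v c = yb (fun k => bit (x k)) + (2 : O) • w := by
  have h : ∀ k, x k = (bif bit (x k) then 1 else 0 : ℤ) + 2 * (x k / 2) := by
    intro k
    rcases Int.emod_two_eq_zero_or_one (x k) with h | h <;> simp [bit, h] <;> omega
  refine ⟨∑ k, (x k / 2) • ZB k, ?_, ?_⟩
  · exact Submodule.sum_mem _ fun k _ => zsmul_mem ((mem_J_iff _).2 (ZB_par k)) _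
  · rw [hx, yb, Finset.smul_sum, ← Finset.sum_add_distrib]
    refine Finset.sum_congr rfl fun k _ => ?_
    have e : (2 : O) • (x k / 2) • ZB k = (2 * (x k / 2)) • ZB k := by
      rw [mul_smul, two_smul, two_smul]
    rw [e, ← add_smul, ← h]

theorem E8_iff (u : O) : E8 u ↔ 8 ∣ u := by
  constructor
  · rintro ⟨⟨a, h1⟩, ⟨b, h2⟩⟩
    exact ⟨⟨a, b⟩, by ext <;> simp [h1, h2]⟩
  · rintro ⟨z, rfl⟩
    exact ⟨⟨z.re, by simp⟩, ⟨z.im, by simp⟩⟩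

theorem yb_mem (b : Fin 8 → Bool) : yb b ∈ J :=
  Submodule.sum_mem _ fun k _ => zsmul_mem ((mem_J_iff _).2 (ZB_par k)) _

theorem nrm_even (c : Ico) (x : Fin 8 → ℤ) (hx : v c = ∑ k, x k • ZB k) :
    2 ∣ nrm c ↔ E8 (nsq (yb (fun k => bit (x k)))) := by
  obtain ⟨w, hw, h⟩ := split_bits c x hx
  have hwc : cj w ∈ J := by
    have := v_mem (conj (mk w hw)); rwa [v_conj, v_mk] at this
  obtain ⟨z, -, hz⟩ := J_mul (yb_mem (fun k => bit (x k))) hwc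
  have hw4 := four_nrm (mk w hw)
  rw [v_mk] at hw4
  have hre := congrArg QuaternionAlgebra.re hz
  simp [cj] at hre
  have h4 := four_nrm c
  rw [h] at h4
  set y := yb (fun k => bit (x k))
  have e : 4 * nrm c = nsq y + 8 * (z.re + 2 * nrm (mk w hw)) := by
    rw [h4]
    have : nsq (y + (2 : O) • w) = nsq y + 4 * (y.re * w.re + y.imI * w.imI + y.imJ * w.imJ + y.imK * w.imK)
      + 4 * nsq w := by
      simp [nsq]; ring
    rw [this, ← hw4]
    linear_combination 4 * hre
  rw [E8_iff]
  constructor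
  · rintro ⟨t, ht⟩
    exact ⟨t - (z.re + 2 * nrm (mk w hw)), by linear_combination (-1 : O) * e + 4 * ht⟩
  · rintro ⟨t, ht⟩
    exact ⟨t + (z.re + 2 * nrm (mk w hw)), mul_left_cancel₀ four_ne (by linear_combination e + ht)⟩

theorem odd_A (c : Ico) (h : ¬ 2 ∣ nrm c) : ∃ i, ∀ j, L (c * hu j) ↔ j = i := by
  obtain ⟨x, hx⟩ := exists_coord c
  simp only [L_A c x hx]
  rw [nrm_even c x hx] at h
  rw [vec8 (fun k => bit (x k))] at h ⊢
  exact checkA _ _ _ _ _ _ _ _ h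

theorem even_B (c : Ico) (h : 2 ∣ nrm c) (h' : ¬ ∃ c', c = (2 : O) • c') :
    ∃ i, ∀ j : Fin 5 × Fin 5, L (hp j.1 * c * hp j.2) ↔ j = i := by
  obtain ⟨x, hx⟩ := exists_coord c
  simp only [L_B c x hx]
  rw [nrm_even c x hx] at h
  rw [vec8 (fun k => bit (x k))] at h ⊢
  refine checkB _ _ _ _ _ _ _ _ ?_ h
  by_contra hc
  apply h'
  obtain ⟨w, hw, hvw⟩ := split_bits c x hx
  refine ⟨mk w hw, v_inj ?_⟩
  rw [map_smul, v_mk, hvw]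
  have : yb (fun k => bit (x k)) = 0 := by
    simp only [Bool.or_eq_true, not_or, Bool.not_eq_true] at hc
    obtain ⟨⟨⟨⟨⟨⟨⟨h0, h1⟩, h2⟩, h3⟩, h4⟩, h5⟩, h6⟩, h7⟩ := hc
    simp only [yb, Fin.sum_univ_eight, h0, h1, h2, h3, h4, h5, h6, h7, cond_false, zero_smul, add_zero]
  rw [this, zero_add]

theorem card_aux {X G : Type*} [Finite X] [Finite G] (P : X → G → Prop) (Q : X → Prop)
    (e : G → X ≃ X) (hP : ∀ x, ∃ i, ∀ j, P x j ↔ j = i) (hQ : ∀ x j, P x j ↔ Q (e j x)) :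
    Nat.card X = Nat.card {x // Q x} * Nat.card G := by
  rw [← Nat.card_prod]
  choose f hf using hP
  refine Nat.card_eq_of_bijective (fun x => (⟨e (f x) x, (hQ _ _).1 ((hf x _).2 rfl)⟩, f x)) ⟨?_, ?_⟩
  · intro x y h
    have h2 : f x = f y := congrArg Prod.snd h
    have h1 : e (f x) x = e (f y) y := congrArg (fun z => z.1.1) h
    rw [h2] at h1
    exact (e (f y)).injective h1
  · rintro ⟨⟨y, hy⟩, j⟩
    obtain ⟨x, rfl⟩ := (e j).surjective y
    have : f x = j := ((hf x j).1 ((hQ x j).2 hy)).symm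
    subst this
    exact ⟨x, rfl⟩

/-- multiplication by units of norm one -/
noncomputable def mulE (m : O) (a b : Ico) (ha : nrm a = 1) (hb : nrm b = 1) : S m ≃ S m where
  toFun c := ⟨a * c.1 * b, by rw [nrm_mul, nrm_mul, ha, hb, c.2, one_mul, mul_one]⟩
  invFun c := ⟨conj a * c.1 * conj b, by rw [nrm_mul, nrm_mul, nrm_conj, nrm_conj, ha, hb, c.2, one_mul, mul_one]⟩
  left_inv c := by
    apply Subtype.ext
    change conj a * (a * c.1 * b) * conj b = c.1
    rw [mul_assoc a, ← mul_assoc (conj a), one_of_nrm' ha, one_mul, mul_assoc, one_of_nrm hb, mul_one]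
  right_inv c := by
    apply Subtype.ext
    change a * (conj a * c.1 * conj b) * b = c.1
    rw [mul_assoc (conj a), ← mul_assoc a, one_of_nrm ha, one_mul, mul_assoc, one_of_nrm' hb, mul_one]

/-- number of Lipschitz quaternions of given norm -/
noncomputable def rL (m : O) : ℕ := Nat.card {y : H // nsq y = m}

theorem rL_eq (m : O) : rL m = Nat.card {c : S m // L c.1} := by
  symm
  have hd : ∀ c : {c : S m // L c.1}, ∃ y : H, v c.1.1 = (2 : O) • y := by
    rintro ⟨⟨c, hc⟩, hl⟩
    have hl' : ∀ l, ∃ y, co l (v c) = 2 * y := hl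
    choose y hy using hl'
    refine ⟨⟨⟨y 0, y 1⟩, ⟨y 2, y 3⟩, ⟨y 4, y 5⟩, ⟨y 6, y 7⟩⟩, ?_⟩
    apply co_ext
    intro l
    rw [hy l]
    fin_cases l <;> simp [co]
  choose f hf using hd
  have hn : ∀ c, nsq (f c) = m := by
    intro c
    have := four_nrm c.1.1
    rw [hf, nsq_smul, c.1.2] at this
    exact mul_left_cancel₀ four_ne (by linear_combination -this)
  refine Nat.card_eq_of_bijective (fun c => ⟨f c, hn c⟩) ⟨?_, ?_⟩
  · intro c d h
    have h : f c = f d := congrArg Subtype.val h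
    apply Subtype.ext; apply Subtype.ext; apply v_inj
    rw [hf, hf, h]
  · rintro ⟨y, hy⟩
    let c : {c : S m // L c.1} := ⟨⟨mk _ (two_H y), by
      apply mul_left_cancel₀ four_ne
      rw [four_nrm, v_mk, nsq_smul, hy]; ring⟩, by
      intro l; simp only [v_mk]; rw [co_two]; exact Dvd.intro _ rfl⟩
    refine ⟨c, ?_⟩
    apply Subtype.ext
    apply two_smul_inj
    simp only [← hf]
    rfl

theorem rL_odd {m : O} (h : ¬ 2 ∣ m) : r m = rL m * 15 := by
  rw [rL_eq, r]
  have := card_aux (X := S m) (G := Fin 15) (fun c j => L (c.1 * hu j)) (fun c => L c.1)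
    (fun j => mulE m 1 (hu j) nrm_one (nrm_hu j)) (fun c => odd_A c.1 (by rw [c.2]; exact h))
    (fun c j => by simp only [mulE, Equiv.coe_fn_mk, one_mul])
  simpa using this

theorem smul_iff {a b c : Ico} (ha : nrm a = 1) (hb : nrm b = 1) :
    (∃ c', a * c * b = (2 : O) • c') ↔ ∃ c', c = (2 : O) • c' := by
  constructor
  · rintro ⟨c', h⟩
    refine ⟨conj a * c' * conj b, ?_⟩
    rw [← smul_mul', ← mul_smul', ← h, mul_assoc a, ← mul_assoc (conj a), one_of_nrm' ha, one_mul, mul_assoc, one_of_nrm hb, mul_one]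
  · rintro ⟨c', rfl⟩
    exact ⟨a * c' * b, by rw [mul_smul', smul_mul']⟩

theorem rL_even {m : O} (h : 2 ∣ m) :
    r m + 24 * Nat.card {x : Ico // 4 * nrm x = m} = rL m * 25 := by
  classical
  let Z : S m → Prop := fun c => ∃ c', c.1 = (2 : O) • c'
  have h1 : Nat.card {c : S m // ¬ Z c} = Nat.card {c : {c : S m // ¬ Z c} // L c.1.1} * 25 := by
    have := card_aux (X := {c : S m // ¬ Z c}) (G := Fin 5 × Fin 5)
      (fun c j => L (hp j.1 * c.1.1 * hp j.2)) (fun c => L c.1.1)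
      (fun j => (mulE m (hp j.1) (hp j.2) (nrm_hp _) (nrm_hp _)).subtypeEquiv (fun c => by
        rw [not_iff_not]; exact (smul_iff (nrm_hp _) (nrm_hp _)).symm))
      (fun c => even_B c.1.1 (by rw [c.1.2]; exact h) c.2)
      (fun c j => by simp [mulE])
    simpa using this
  have hs : Nat.card {c : S m // Z c} = Nat.card {x : Ico // 4 * nrm x = m} := by
    symm
    refine Nat.card_eq_of_bijective (fun x => ⟨⟨(2 : O) • x.1, by
      rw [nrm_smul]; linear_combination x.2⟩, ⟨x.1, rfl⟩⟩) ⟨?_, ?_⟩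
    · intro x y h
      have h : (2 : O) • x.1 = (2 : O) • y.1 := congrArg (fun z => z.1.1) h
      apply Subtype.ext
      apply v_inj
      apply two_smul_inj
      rw [← map_smul, h, map_smul]
    · rintro ⟨⟨α, hα⟩, ⟨α', h⟩⟩
      simp only at h
      subst h
      refine ⟨⟨α', ?_⟩, rfl⟩
      rw [nrm_smul] at hα
      rw [← hα]; ring
  have hL : ∀ c : S m, Z c → L c.1 := by
    rintro ⟨c, hc⟩ ⟨c', h⟩ l
    change c = _ at h
    change 2 ∣ co l (v c)
    rw [h, map_smul, co_two]; exact Dvd.intro _ rfl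
  have e1 : Nat.card (S m) = Nat.card {c : S m // Z c} + Nat.card {c : S m // ¬ Z c} := by
    rw [← Nat.card_sum]
    exact Nat.card_congr (Equiv.sumCompl Z).symm
  have e2 : Nat.card {c : S m // L c.1} = Nat.card {c : S m // Z c} + Nat.card {c : {c : S m // ¬ Z c} // L c.1.1} := by
    rw [← Nat.card_congr (Equiv.sumCompl (fun c : {c : S m // L c.1} => Z c.1)), Nat.card_sum]
    congr 1
    · exact Nat.card_congr ((Equiv.subtypeSubtypeEquivSubtype (fun {c} h => hL c h)))
    · exact Nat.card_congr ((Equiv.subtypeSubtypeEquivSubtypeInter (fun c : S m => L c.1) (fun c => ¬ Z c)).trans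
        ((Equiv.subtypeEquivRight fun c => and_comm).trans
          (Equiv.subtypeSubtypeEquivSubtypeInter (fun c => ¬ Z c) (fun c : S m => L c.1)).symm))
  rw [r, rL_eq, e2, e1, ← hs]
  omega

end Ico
end FS5

namespace FS5
open QuadraticAlgebra
namespace Ico

def tq (k : Fin 3) : ℤ := (k : ℕ) - 1

theorem tq_inj : Function.Injective tq := by
  intro a b h; simp only [tq] at h; exact Fin.ext (by omega)

theorem nsq_coords (y : H) (n : ℤ) : nsq y = (n : O) ↔
    (y.re.re ^ 2 + y.re.im ^ 2 + y.imI.re ^ 2 + y.imI.im ^ 2 + y.imJ.re ^ 2 + y.imJ.im ^ 2 +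
      y.imK.re ^ 2 + y.imK.im ^ 2 = n ∧
    2 * (y.re.re * y.re.im + y.imI.re * y.imI.im + y.imJ.re * y.imJ.im + y.imK.re * y.imK.im) +
      (y.re.im ^ 2 + y.imI.im ^ 2 + y.imJ.im ^ 2 + y.imK.im ^ 2) = 0) := by
  have hc : (n : O) = ⟨n, 0⟩ := rfl
  rw [hc, QuadraticAlgebra.ext_iff]
  simp only [nsq, sq]
  simp
  constructor <;> rintro ⟨h1, h2⟩ <;> constructor <;> linarith

theorem tq_of {a : ℤ} (h : a ^ 2 ≤ 2) : ∃ k, tq k = a := by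
  have h1 : -1 ≤ a := by nlinarith
  have h2 : a ≤ 1 := by nlinarith
  interval_cases a
  · exact ⟨0, rfl⟩
  · exact ⟨1, rfl⟩
  · exact ⟨2, rfl⟩

theorem sq4_zero {a b c d : ℤ} (h : a ^ 2 + b ^ 2 + c ^ 2 + d ^ 2 = 0) :
    a = 0 ∧ b = 0 ∧ c = 0 ∧ d = 0 := by
  have := sq_nonneg a
  have := sq_nonneg b
  have := sq_nonneg c
  have := sq_nonneg d
  refine ⟨?_, ?_, ?_, ?_⟩ <;> refine pow_eq_zero_iff (two_ne_zero) |>.1 ?_ <;> omega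

theorem sq4_le {a b c d n : ℤ} (h : a ^ 2 + b ^ 2 + c ^ 2 + d ^ 2 = n) (hn : n ≤ 2) :
    a ^ 2 ≤ 2 ∧ b ^ 2 ≤ 2 ∧ c ^ 2 ≤ 2 ∧ d ^ 2 ≤ 2 := by
  have := sq_nonneg a
  have := sq_nonneg b
  have := sq_nonneg c
  have := sq_nonneg d
  refine ⟨?_, ?_, ?_, ?_⟩ <;> omega

theorem rL_small (n : ℤ) (h1 : 1 ≤ n) (h2 : n ≤ 2) : rL (n : O) =
    Nat.card {z : Fin 4 → Fin 3 // tq (z 0) ^ 2 + tq (z 1) ^ 2 + tq (z 2) ^ 2 + tq (z 3) ^ 2 = n} := by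
  symm
  refine Nat.card_eq_of_bijective (fun z => ⟨⟨⟨tq (z.1 0), 0⟩, ⟨tq (z.1 1), 0⟩, ⟨tq (z.1 2), 0⟩, ⟨tq (z.1 3), 0⟩⟩, by
    rw [nsq_coords]; simp [z.2]⟩) ⟨?_, ?_⟩
  · intro z w h
    have h := congrArg Subtype.val h
    simp only [QuaternionAlgebra.mk.injEq, QuadraticAlgebra.mk.injEq, and_true] at h
    apply Subtype.ext
    funext k
    apply tq_inj
    fin_cases k
    exacts [h.1, h.2.1, h.2.2.1, h.2.2.2]
  · rintro ⟨⟨⟨a, b⟩, ⟨c, d⟩, ⟨e, f⟩, ⟨g, h⟩⟩, hy⟩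
    have hy' := (nsq_coords _ _).1 hy
    simp only at hy'
    obtain ⟨e1, e2⟩ := hy'
    have hB : b ^ 2 + d ^ 2 + f ^ 2 + h ^ 2 = 0 := by
      have hev : (b ^ 2 + d ^ 2 + f ^ 2 + h ^ 2) % 2 = 0 := by omega
      have hle : b ^ 2 + d ^ 2 + f ^ 2 + h ^ 2 ≤ 2 := by
        linarith [sq_nonneg a, sq_nonneg c, sq_nonneg e, sq_nonneg g]
      have hge : 0 ≤ b ^ 2 + d ^ 2 + f ^ 2 + h ^ 2 := by positivity
      by_contra hne
      have hB2 : b ^ 2 + d ^ 2 + f ^ 2 + h ^ 2 = 2 := by omega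
      have hA : a ^ 2 + c ^ 2 + e ^ 2 + g ^ 2 = 0 := by
        have : 0 ≤ a ^ 2 + c ^ 2 + e ^ 2 + g ^ 2 := by positivity
        omega
      obtain ⟨ha, hc, he, hg⟩ := sq4_zero hA
      subst ha hc he hg
      omega
    obtain ⟨hb, hd, hf, hh⟩ := sq4_zero hB
    subst hb hd hf hh
    obtain ⟨l0, l1, l2, l3⟩ := sq4_le (a := a) (b := c) (c := e) (d := g) (n := n) (by linarith) h2
    obtain ⟨k0, rfl⟩ := tq_of l0
    obtain ⟨k1, rfl⟩ := tq_of l1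
    obtain ⟨k2, rfl⟩ := tq_of l2
    obtain ⟨k3, rfl⟩ := tq_of l3
    exact ⟨⟨![k0, k1, k2, k3], by simpa using e1⟩, rfl⟩

theorem rL_one : rL 1 = 8 := by
  have := rL_small 1 le_rfl (by norm_num)
  rw [Int.cast_one] at this
  rw [this, Nat.card_eq_fintype_card, Fintype.card_subtype]
  decide +kernel

theorem rL_two : rL 2 = 24 := by
  have := rL_small 2 (by norm_num) le_rfl
  rw [Int.cast_ofNat] at this
  rw [this, Nat.card_eq_fintype_card, Fintype.card_subtype]
  decide +kernel

theorem two_dvd_iff (x : O) : 2 ∣ x ↔ 2 ∣ nm x := by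
  constructor
  · rintro ⟨y, rfl⟩
    rw [nm_mul]
    exact Dvd.dvd.mul_right (by decide) _
  · intro h
    simp only [nm] at h
    have h2 : 2 ∣ x.re ∧ 2 ∣ x.im := by
      rcases Int.even_or_odd' x.re with ⟨a, ha | ha⟩ <;> rcases Int.even_or_odd' x.im with ⟨b, hb | hb⟩ <;>
        rw [ha, hb] at h ⊢
      · exact ⟨⟨a, rfl⟩, ⟨b, rfl⟩⟩
      all_goals ring_nf at h; omega
    obtain ⟨⟨a, ha⟩, ⟨b, hb⟩⟩ := h2
    exact ⟨⟨a, b⟩, by ext <;> simp [ha, hb]⟩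

theorem prime_two : Prime (2 : O) := by
  refine ⟨by decide, fun h => ?_, fun a b h => ?_⟩
  · rcases nm_unit h with h | h <;> revert h <;> decide
  · rw [two_dvd_iff, nm_mul] at h
    rw [two_dvd_iff, two_dvd_iff]
    exact Int.prime_two.dvd_or_dvd h

theorem r_one : r 1 = 120 := by
  rw [rL_odd, rL_one]
  intro h
  exact prime_two.not_isUnit (isUnit_of_dvd_one h)

theorem r_two : r 2 = 600 := by
  have := rL_even (m := 2) dvd_rfl
  have h0 : Nat.card {x : Ico // 4 * nrm x = 2} = 0 := by
    rw [Nat.card_eq_zero]; left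
    refine ⟨fun x => ?_⟩
    apply prime_two.not_isUnit
    refine IsUnit.of_mul_eq_one (nrm x.1) ?_
    apply mul_left_cancel₀ prime_two.ne_zero
    linear_combination x.2
  rw [h0, rL_two] at this
  omega

theorem tp_two : TP 2 := tp_of (by decide) (by decide)

end Ico

end FS5

namespace FS5
open QuadraticAlgebra

noncomputable section

def sg (I : Ideal O) : ℤ := ∑ᶠ J ∈ {J : Ideal O | J ∣ I}, (Ideal.absNorm J : ℤ)
def us (Q I : Ideal O) : ℤ := ∑ᶠ J ∈ {J : Ideal O | J ∣ I ∧ Q ∣ J}, (Ideal.absNorm J : ℤ)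
def ts (Q I : Ideal O) : ℤ := ∑ᶠ J ∈ {J : Ideal O | J ∣ I ∧ ¬ Q ∣ J}, (Ideal.absNorm J : ℤ)

theorem fin_dvd {I : Ideal O} (hI : I ≠ ⊥) : {J : Ideal O | J ∣ I}.Finite := by
  have := UniqueFactorizationMonoid.fintypeSubtypeDvd I hI
  exact Set.finite_coe_iff.1 (Finite.of_fintype {J : Ideal O // J ∣ I})

theorem sg_eq (Q : Ideal O) {I : Ideal O} (hI : I ≠ ⊥) : sg I = ts Q I + us Q I := by
  rw [sg, ts, us, ← finsum_mem_union]
  · refine finsum_mem_congr ?_ fun _ _ => rfl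
    ext J
    simp only [Set.mem_ofPred_eq, Set.mem_union]
    tauto
  · rw [Set.disjoint_left]
    rintro J ⟨_, h⟩ ⟨_, h'⟩; exact h h'
  · exact (fin_dvd hI).subset fun J h => h.1
  · exact (fin_dvd hI).subset fun J h => h.1

theorem us_mul {Q : Ideal O} (hQ : Q ≠ ⊥) {I : Ideal O} (hI : I ≠ ⊥) :
    us Q (Q * I) = Ideal.absNorm Q * sg I := by
  have : {J : Ideal O | J ∣ Q * I ∧ Q ∣ J} = (fun J => Q * J) '' {J | J ∣ I} := by
    ext J
    simp only [Set.mem_ofPred_eq, Set.mem_image]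
    constructor
    · rintro ⟨h, J, rfl⟩
      exact ⟨J, (mul_dvd_mul_iff_left hQ).1 h, rfl⟩
    · rintro ⟨J, h, rfl⟩
      exact ⟨mul_dvd_mul_left _ h, dvd_mul_right _ _⟩
  rw [us, this, finsum_mem_image, sg, mul_finsum_mem]
  · simp
  · intro a _ b _ h
    exact mul_left_cancel₀ hQ h

theorem us_zero {Q I : Ideal O} (h : ¬ Q ∣ I) : us Q I = 0 := by
  rw [us]
  have : {J : Ideal O | J ∣ I ∧ Q ∣ J} = ∅ := by
    ext J
    simp only [Set.mem_ofPred_eq, Set.mem_empty_iff_false, iff_false]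
    rintro ⟨h1, h2⟩; exact h (h2.trans h1)
  rw [this, finsum_mem_empty]

theorem ts_mul {P : Ideal O} (hP : Prime P) {I : Ideal O} : ts P (P * I) = ts P I := by
  have : {J : Ideal O | J ∣ P * I ∧ ¬ P ∣ J} = {J : Ideal O | J ∣ I ∧ ¬ P ∣ J} := by
    ext J
    simp only [Set.mem_ofPred_eq]
    constructor
    · rintro ⟨h, h'⟩
      refine ⟨?_, h'⟩
      have hJ : J ≠ 0 := by rintro rfl; exact h' (dvd_zero _)
      refine UniqueFactorizationMonoid.dvd_of_dvd_mul_right_of_no_prime_factors hJ ?_ h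
      intro d hd hdP hpd
      apply h'
      exact (((hpd.dvd_prime_iff_associated hP).1 hdP).dvd_iff_dvd_left).1 hd
    · rintro ⟨h, h'⟩
      exact ⟨h.mul_left _, h'⟩
  rw [ts, this, ts]

theorem sg_step {P : Ideal O} (hP : Prime P) {I : Ideal O} (hI : I ≠ ⊥) :
    sg (P * (P * I)) + Ideal.absNorm P * sg I = (Ideal.absNorm P + 1) * sg (P * I) := by
  have h1 := mul_ne_zero hP.ne_zero hI
  have h2 := mul_ne_zero hP.ne_zero h1
  have a1 := sg_eq P h1
  have a2 := sg_eq P h2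
  rw [ts_mul hP, us_mul hP.ne_zero h1] at a2
  rw [us_mul hP.ne_zero hI] at a1
  linarith

theorem sg_step' {P : Ideal O} (hP : Prime P) {I : Ideal O} (hI : I ≠ ⊥) (h : ¬ P ∣ I) :
    sg (P * I) = (Ideal.absNorm P + 1) * sg I := by
  have h1 := mul_ne_zero hP.ne_zero hI
  have a0 := sg_eq P hI
  have a1 := sg_eq P h1
  rw [us_zero h] at a0
  rw [us_mul hP.ne_zero hI, ts_mul hP] at a1
  linarith

theorem sg_top : sg ⊤ = 1 := by
  have : {J : Ideal O | J ∣ ⊤} = {⊤} := by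
    ext J
    simp only [Set.mem_ofPred_eq, Set.mem_singleton_iff]
    rw [← Ideal.one_eq_top, ← isUnit_iff_dvd_one, Ideal.isUnit_iff, Ideal.one_eq_top]
  rw [sg, this, finsum_mem_singleton]
  simp

abbrev sp (x : O) : Ideal O := Ideal.span {x}

theorem sp_mul (x y : O) : sp (x * y) = sp x * sp y := (Ideal.span_singleton_mul_span_singleton x y).symm

theorem sp_ne {x : O} (h : x ≠ 0) : sp x ≠ ⊥ := by simpa [sp] using h

theorem sp_dvd {x y : O} : sp x ∣ sp y ↔ x ∣ y := by
  rw [Ideal.dvd_iff_le, Ideal.span_singleton_le_span_singleton]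

theorem sp_prime {x : O} (h : Prime x) : Prime (sp x) :=
  Ideal.prime_of_isPrime (sp_ne h.ne_zero) ((Ideal.span_singleton_prime h.ne_zero).2 h)

theorem sp_assoc {x y : O} (h : Associated x y) : sp x = sp y :=
  Ideal.span_singleton_eq_span_singleton.2 h

namespace Ico

theorem r_eq_card {π : O} (hπ : Prime π) (hT : TP π) (h2 : ¬ π ∣ 2) :
    r π = 120 * (Ideal.absNorm (sp π) + 1) := by
  have hp := (Ideal.span_singleton_prime hπ.ne_zero).2 hπ
  have hm : (sp π).IsMaximal := hp.isMaximal (sp_ne hπ.ne_zero)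
  let _ := Ideal.Quotient.field (sp π)
  have hc : Ideal.absNorm (sp π) = Nat.card (O ⧸ sp π) := by
    rw [Ideal.absNorm_apply, Submodule.cardQuot_apply]
  have hf : Finite (O ⧸ sp π) := by
    apply Nat.finite_of_card_ne_zero
    rw [← hc, Ne, Ideal.absNorm_eq_zero_iff]
    exact sp_ne hπ.ne_zero
  rw [hc, ← r_one]
  refine r_prime hπ hT h2 (Ideal.Quotient.mk (sp π)) Ideal.Quotient.mk_surjective ?_
  intro x
  rw [Ideal.Quotient.eq_zero_iff_mem, Ideal.mem_span_singleton]

theorem absNorm_two : Ideal.absNorm (sp 2) = 4 := by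
  rw [Ideal.absNorm_span_singleton]
  have : (2 : O) = algebraMap ℤ O 2 := by simp
  rw [this, Algebra.norm_algebraMap, QuadraticAlgebra.finrank_eq_two]
  norm_num

theorem absNorm_four : Ideal.absNorm (sp 4) = 16 := by
  rw [show (4 : O) = 2 * 2 by norm_num, sp_mul, map_mul, absNorm_two]

/-- Hecke relation -/
theorem hecke {π : O} (hπ : Prime π) (hT : TP π) (h2 : ¬ π ∣ 2 ∨ π = 2) (m : O) :
    (Ideal.absNorm (sp π) + 1) * r m = r (π * m) +
      Ideal.absNorm (sp π) * Nat.card {x : Ico // π * nrm x = m} := by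
  have hr : r π = 120 * (Ideal.absNorm (sp π) + 1) := by
    rcases h2 with h2 | rfl
    · exact r_eq_card hπ hT h2
    · rw [r_two, absNorm_two]
  have := count_pairs hπ hT m
  rw [hr, r_one] at this
  nlinarith

theorem card_mul {π : O} (h : π ≠ 0) (m : O) : Nat.card {x : Ico // π * nrm x = π * m} = r m := by
  refine Nat.card_congr (Equiv.subtypeEquivRight fun x => ?_)
  exact ⟨fun H => mul_left_cancel₀ h H, fun H => by rw [H]⟩

theorem card_ndvd {π m : O} (h : ¬ π ∣ m) : Nat.card {x : Ico // π * nrm x = m} = 0 := by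
  rw [Nat.card_eq_zero]; left
  exact ⟨fun x => h ⟨_, x.2.symm⟩⟩

theorem r_unit {e : O} (he : IsUnit e) (m : O) : r (e ^ 2 * m) = r m := by
  obtain ⟨u, rfl⟩ := he
  refine Nat.card_congr ?_
  refine ⟨fun x => ⟨(↑u⁻¹ : O) • x.1, ?_⟩, fun x => ⟨(u : O) • x.1, ?_⟩, ?_, ?_⟩
  · rw [nrm_smul, x.2, ← mul_assoc, ← mul_pow]; simp
  · rw [nrm_smul, x.2]
  · intro x; apply Subtype.ext; simp [smul_smul]
  · intro x; apply Subtype.ext; simp [smul_smul]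

theorem good_prime {m : O} (h0 : m ≠ 0) (hu : ¬ IsUnit m) :
    ∃ π, Prime π ∧ TP π ∧ (¬ π ∣ 2 ∨ π = 2) ∧ π ∣ m := by
  obtain ⟨p, hp, hd⟩ := WfDvdMonoid.exists_irreducible_factor hu h0
  have hp' := hp.prime
  obtain ⟨π, hT, ha⟩ := exists_tp_assoc hp'.ne_zero
  have hπ : Prime π := ha.prime_iff.1 hp'
  have hd' : π ∣ m := ha.dvd_iff_dvd_left.1 hd
  by_cases h2 : π ∣ 2
  · exact ⟨2, prime_two, tp_two, Or.inr rfl,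
      ((hπ.dvd_prime_iff_associated prime_two).1 h2).dvd_iff_dvd_left.1 hd'⟩
  · exact ⟨π, hπ, hT, Or.inl h2, hd'⟩

theorem nm_lt {π m : O} (hπ : Prime π) (hm : m ≠ 0) : (nm m).natAbs < (nm (π * m)).natAbs := by
  rw [nm_mul, Int.natAbs_mul]
  have h0 : (nm m).natAbs ≠ 0 := by rw [Int.natAbs_ne_zero]; exact fun h => hm (nm_eq_zero.1 h)
  have h1 : (nm π).natAbs ≠ 0 := by rw [Int.natAbs_ne_zero]; exact fun h => hπ.ne_zero (nm_eq_zero.1 h)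
  have h2 : (nm π).natAbs ≠ 1 := by
    intro h
    apply hπ.not_isUnit
    have hyy : π * ⟨π.re + π.im, -π.im⟩ = ⟨nm π, 0⟩ := by ext <;> simp [nm] <;> ring
    rcases Int.natAbs_eq_iff.1 h with h | h
    · refine IsUnit.of_mul_eq_one _ (hyy.trans ?_)
      rw [h]; rfl
    · refine IsUnit.of_mul_eq_one (-(⟨π.re + π.im, -π.im⟩ : O)) ?_
      rw [mul_neg, hyy, h]; rfl
  have : 2 ≤ (nm π).natAbs := by omega
  nlinarith [Nat.pos_of_ne_zero h0]

theorem r_eq_sg (n : ℕ) : ∀ m : O, TP m → (nm m).natAbs = n → (r m : ℤ) = 120 * sg (sp m) := by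
  induction n using Nat.strong_induction_on with
  | _ n ih =>
  intro m hm hn
  by_cases hu : IsUnit m
  · obtain ⟨e, rfl⟩ := tp_unit_sq hm hu
    have he : IsUnit e := (isUnit_pow_iff two_ne_zero).1 hu
    have h1 := r_unit he 1
    rw [mul_one] at h1
    have h2 : sp (e ^ 2) = ⊤ := Ideal.span_singleton_eq_top.2 hu
    rw [h1, h2, sg_top, r_one]; norm_num
  obtain ⟨π, hπ, hT, h2, m', rfl⟩ := good_prime hm.ne_zero hu
  have hm' : TP m' := hT.of_mul hm
  have i1 := ih _ (hn ▸ nm_lt hπ hm'.ne_zero) m' hm' rfl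
  have hk := hecke hπ hT h2 m'
  have hP := sp_prime hπ
  by_cases hd : π ∣ m'
  · obtain ⟨m'', rfl⟩ := hd
    have hm'' : TP m'' := hT.of_mul hm'
    have i2 := ih _ (hn ▸ (nm_lt hπ hm''.ne_zero).trans (nm_lt hπ hm'.ne_zero)) m'' hm'' rfl
    rw [card_mul hπ.ne_zero] at hk
    have hs := sg_step hP (sp_ne hm''.ne_zero)
    rw [← sp_mul, ← sp_mul] at hs
    zify at hk
    rw [i1, i2] at hk
    linarith
  · rw [card_ndvd hd] at hk
    have hs := sg_step' hP (sp_ne hm'.ne_zero) (fun h => hd (sp_dvd.1 h))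
    rw [← sp_mul] at hs
    zify at hk
    rw [i1] at hk
    rw [hs]; linarith

theorem main_O {m : O} (hm : TP m) :
    (rL m : ℤ) = 8 * sg (sp m) - 4 * us (sp 2) (sp m) + 8 * us (sp 4) (sp m) := by
  have h1 := r_eq_sg _ m hm rfl
  have h42 : (4 : O) = 2 * 2 := by norm_num
  by_cases h2 : 2 ∣ m
  · have he := rL_even h2
    obtain ⟨m', rfl⟩ := h2
    have hm' : TP m' := tp_two.of_mul hm
    have i1 := r_eq_sg _ m' hm' rfl
    have hu2 : us (sp 2) (sp (2 * m')) = 4 * sg (sp m') := by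
      rw [sp_mul, us_mul (sp_ne prime_two.ne_zero) (sp_ne hm'.ne_zero), absNorm_two]; norm_num
    have hP := sp_prime prime_two
    by_cases hd : 2 ∣ m'
    · obtain ⟨m'', rfl⟩ := hd
      have hm'' : TP m'' := tp_two.of_mul hm'
      have i2 := r_eq_sg _ m'' hm'' rfl
      have hs := sg_step hP (sp_ne hm''.ne_zero)
      rw [← sp_mul, ← sp_mul, absNorm_two] at hs
      have e4 : (2 : O) * (2 * m'') = 4 * m'' := by ring
      have hu4 : us (sp 4) (sp (2 * (2 * m''))) = 16 * sg (sp m'') := by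
        rw [e4, sp_mul, us_mul (sp_ne (by decide)) (sp_ne hm''.ne_zero), absNorm_four]; norm_num
      have hc : Nat.card {x : Ico // 4 * nrm x = 2 * (2 * m'')} = r m'' := by
        rw [e4]; exact card_mul (by decide) _
      rw [hc] at he
      zify at he
      rw [h1, i2] at he
      rw [hu2, hu4]
      push_cast at hs
      linarith
    · have hs := sg_step' hP (sp_ne hm'.ne_zero) (fun h => hd (sp_dvd.1 h))
      rw [← sp_mul, absNorm_two] at hs
      have h4 : ¬ (4 : O) ∣ 2 * m' := by
        rw [h42, mul_dvd_mul_iff_left prime_two.ne_zero]; exact hd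
      rw [card_ndvd h4] at he
      rw [hu2, us_zero (fun h => h4 (sp_dvd.1 h))]
      zify at he
      rw [h1] at he
      push_cast at hs
      linarith
  · have ho := rL_odd h2
    have h4 : ¬ (4 : O) ∣ m := fun h => h2 ((h42 ▸ dvd_mul_right (2 : O) 2).trans h)
    rw [us_zero (fun h => h2 (sp_dvd.1 h)), us_zero (fun h => h4 (sp_dvd.1 h))]
    zify at ho
    linarith

end Ico
end
end FS5

namespace FS5
open QuadraticAlgebra
open NumberField

noncomputable section

/-- the map from `O` to a ring with a root of `x^2 = x + 1`. -/
def embK {K : Type*} [Field K] (t : K) (ht : t * t = t + 1) : O →+* K where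
  toFun x := x.re + x.im * t
  map_one' := by simp [QuadraticAlgebra.re_one, QuadraticAlgebra.im_one]
  map_zero' := by simp
  map_add' x y := by simp; ring
  map_mul' x y := by
    simp
    linear_combination (-(x.im : K) * y.im) * ht

theorem embK_apply {K : Type*} [Field K] (t : K) (ht : t * t = t + 1) (x : O) :
    embK t ht x = x.re + x.im * t := rfl

theorem embK_inj {K : Type*} [Field K] [CharZero K] (t : K) (ht : t * t = t + 1) :
    Function.Injective (embK t ht) := by
  rw [injective_iff_map_eq_zero]
  intro x hx
  have hyy : x * ⟨x.re + x.im, -x.im⟩ = ⟨nm x, 0⟩ := by ext <;> simp [nm] <;> ring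
  have h := congrArg (embK t ht) hyy
  rw [map_mul, hx, zero_mul, embK_apply] at h
  simp only [Int.cast_zero, zero_mul, add_zero] at h
  exact nm_eq_zero.1 (by exact_mod_cast h.symm)

theorem no_rat (q : ℚ) : q * q ≠ q + 1 := by
  intro h
  have h5 : Irrational (Real.sqrt 5) := by
    have := Nat.Prime.irrational_sqrt (p := 5) (by norm_num)
    exact_mod_cast this
  apply h5
  refine ⟨|2 * q - 1|, ?_⟩
  symm
  rw [Real.sqrt_eq_iff_mul_self_eq_of_pos]
  · have : |2 * q - 1| * |2 * q - 1| = 5 := by rw [abs_mul_abs_self]; linear_combination 4 * h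
    exact_mod_cast this
  · have : 0 < |2 * q - 1| := by
      rw [abs_pos]; intro h0
      have : (2 * q - 1) * (2 * q - 1) = 5 := by linear_combination 4 * h
      rw [h0] at this; norm_num at this
    exact_mod_cast this

theorem exists_coords {K : Type*} [Field K] [NumberField K]
    (hdeg : Module.finrank ℚ K = 2) (t : K) (ht : t * t = t + 1) (y : K) :
    ∃ a b : ℚ, y = a + b * t := by
  have hli : LinearIndependent ℚ ![(1 : K), t] := by
    rw [LinearIndependent.pair_iff]
    intro a b h
    rw [Rat.smul_def, Rat.smul_def, mul_one] at h
    by_cases hb : b = 0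
    · subst hb
      simp at h
      exact ⟨h, rfl⟩
    · exfalso
      have hb' : (b : K) ≠ 0 := by exact_mod_cast hb
      have hT : t = ((-a / b : ℚ) : K) := by
        push_cast; field_simp; linear_combination h
      rw [hT] at ht
      exact no_rat _ (by exact_mod_cast ht)
  have hs := hli.span_eq_top_of_card_eq_finrank (by simp [hdeg])
  have hy : y ∈ Submodule.span ℚ (Set.range ![(1 : K), t]) := by rw [hs]; trivial
  rw [Matrix.range_cons, Matrix.range_cons, Matrix.range_empty, Set.union_empty,
    Set.singleton_union, Submodule.mem_span_pair] at hy
  obtain ⟨a, b, h⟩ := hy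
  exact ⟨a, b, by rw [← h, Rat.smul_def, Rat.smul_def, mul_one]⟩

theorem exists_equiv {K : Type*} [Field K] [NumberField K]
    (hdeg : Module.finrank ℚ K = 2) (h5 : ∃ r : K, r ^ 2 = 5)
    (m : 𝓞 K) (hm : ∀ φ : K →+* ℝ, 0 < φ (m : K)) : ∃ g : 𝓞 K ≃+* O, TP (g m) := by
  obtain ⟨r, hr⟩ := h5
  have ht : (1 + r) / 2 * ((1 + r) / 2) = (1 + r) / 2 + 1 := by
    field_simp; linear_combination hr
  generalize (1 + r) / 2 = t at ht
  let _ : Algebra O K := (embK t ht).toAlgebra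
  have hmap : ∀ x : O, algebraMap O K x = x.re + x.im * t := fun _ => rfl
  have hinj : Function.Injective (algebraMap O K) := embK_inj t ht
  have : FaithfulSMul O K := (faithfulSMul_iff_algebraMap_injective O K).2 hinj
  have hfrac : IsFractionRing O K := by
    refine IsFractionRing.of_field O K fun z => ?_
    obtain ⟨a, b, rfl⟩ := exists_coords hdeg t ht z
    refine ⟨⟨a.num * b.den, b.num * a.den⟩, ⟨a.den * b.den, 0⟩, ?_⟩
    have ha : (a.den : K) ≠ 0 := by exact_mod_cast a.den_nz
    have hb : (b.den : K) ≠ 0 := by exact_mod_cast b.den_nz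
    rw [hmap, hmap]
    have e1 : (a : K) = a.num / a.den := Rat.cast_def a
    have e2 : (b : K) = b.num / b.den := Rat.cast_def b
    rw [e1, e2]
    push_cast
    field_simp
    try ring
  have : IsIntegralClosure O ℤ K := inferInstance
  let g : 𝓞 K ≃+* O := RingOfIntegers.equiv O
  have hg : ∀ x : 𝓞 K, algebraMap O K (g x) = (x : K) := by
    intro x
    exact IsIntegralClosure.algebraMap_equiv ℤ (𝓞 K) K O x
  have key : ∀ f : O →+* ℝ, Function.Injective f → 0 < f (g m) := by
    intro f hf
    have := hm (IsFractionRing.lift hf)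
    rw [← hg m, IsFractionRing.lift_algebraMap] at this
    exact this
  exact ⟨g, key e1 (embK_inj _ gold), key e2 (embK_inj _ goldc)⟩

section transfer
variable {K : Type*} [Field K] [NumberField K] (g : 𝓞 K ≃+* O)

theorem map_dvd {I J : Ideal (𝓞 K)} : I.map g ∣ J.map g ↔ I ∣ J := by
  rw [Ideal.dvd_iff_le, Ideal.dvd_iff_le]
  constructor
  · intro h
    have := Ideal.comap_mono (f := g) h
    rwa [Ideal.comap_map_of_bijective _ g.bijective, Ideal.comap_map_of_bijective _ g.bijective] at this
  · intro h; exact Ideal.map_mono h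

theorem map_inj : Function.Injective (fun I : Ideal (𝓞 K) => I.map g) := by
  intro I J h
  have := congrArg (Ideal.comap g) h
  simpa only [Ideal.comap_map_of_bijective _ g.bijective] using this

theorem map_surj (J : Ideal O) : ∃ I : Ideal (𝓞 K), I.map g = J :=
  ⟨J.comap g, Ideal.map_comap_of_surjective _ g.surjective J⟩

theorem map_absNorm (I : Ideal (𝓞 K)) : Ideal.absNorm I = Ideal.absNorm (I.map g) := by
  rw [Ideal.absNorm_apply, Ideal.absNorm_apply, Submodule.cardQuot_apply, Submodule.cardQuot_apply]
  exact Nat.card_congr (Ideal.quotientEquiv I (I.map g) g rfl).toEquiv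

theorem map_sp (x : 𝓞 K) : (Ideal.span {x}).map g = sp (g x) := by
  rw [Ideal.map_span, Set.image_singleton]

theorem finsum_transfer (A : Set (Ideal (𝓞 K))) (B : Set (Ideal O))
    (h : ∀ I, I ∈ A ↔ I.map g ∈ B) :
    ∑ᶠ I ∈ A, (Ideal.absNorm I : ℤ) = ∑ᶠ J ∈ B, (Ideal.absNorm J : ℤ) := by
  refine finsum_mem_eq_of_bijOn (fun I => I.map g) ⟨fun I hI => (h I).1 hI, (map_inj g).injOn, ?_⟩ ?_
  · intro J hJ
    obtain ⟨I, rfl⟩ := map_surj g J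
    exact ⟨I, (h I).2 hJ, rfl⟩
  · intro I _; rw [map_absNorm g]

theorem card_transfer (m : 𝓞 K) :
    Nat.card {x : Fin 4 → 𝓞 K // (∑ i, x i ^ 2) = m} = Ico.rL (g m) := by
  refine Nat.card_congr ⟨fun x => ⟨⟨g (x.1 0), g (x.1 1), g (x.1 2), g (x.1 3)⟩, ?_⟩,
    fun y => ⟨![g.symm y.1.re, g.symm y.1.imI, g.symm y.1.imJ, g.symm y.1.imK], ?_⟩, ?_, ?_⟩
  · have h := congrArg g x.2
    rw [Fin.sum_univ_four] at h
    rw [← h]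
    simp only [nsq, map_add, map_pow]
  · rw [Fin.sum_univ_four]
    apply g.injective
    refine Eq.trans ?_ y.2
    simp [nsq]
  · intro x
    apply Subtype.ext
    funext k
    fin_cases k <;> simp
  · intro y
    apply Subtype.ext
    apply QuaternionAlgebra.ext <;> simp

end transfer

end
end FS5

open NumberField Ideal

theorem four_squares_count_sqrt5
    (K : Type*) [Field K] [NumberField K]
    (hdeg : Module.finrank ℚ K = 2) (hreal : Nonempty (K →+* ℝ))
    (h5 : ∃ r : K, r ^ 2 = 5)
    (m : 𝓞 K) (hm : ∀ φ : K →+* ℝ, 0 < φ (m : K)) :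
    (Nat.card {x : Fin 4 → 𝓞 K // (∑ i, x i ^ 2) = m} : ℤ) =
      8 * (∑ᶠ I ∈ {I : Ideal (𝓞 K) | I ≠ ⊥ ∧ I ∣ Ideal.span {m}},
            (Ideal.absNorm I : ℤ))
        - 4 * (∑ᶠ I ∈ {I : Ideal (𝓞 K) | I ≠ ⊥ ∧ I ∣ Ideal.span {m} ∧
            Ideal.span {(2 : 𝓞 K)} ∣ I}, (Ideal.absNorm I : ℤ))
        + 8 * (∑ᶠ I ∈ {I : Ideal (𝓞 K) | I ≠ ⊥ ∧ I ∣ Ideal.span {m} ∧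
            Ideal.span {(4 : 𝓞 K)} ∣ I}, (Ideal.absNorm I : ℤ)) := by
  obtain ⟨g, hg⟩ := FS5.exists_equiv hdeg h5 m hm
  have hm0 : m ≠ 0 := by
    rintro rfl
    exact hg.ne_zero (map_zero g)
  have hbot : ∀ I : Ideal (𝓞 K), I ∣ Ideal.span {m} → I ≠ ⊥ := by
    rintro _ h rfl
    rw [Ideal.dvd_iff_le, le_bot_iff, Ideal.span_singleton_eq_bot] at h
    exact hm0 h
  have hdm : ∀ I : Ideal (𝓞 K), I ∣ Ideal.span {m} ↔ I.map g ∣ FS5.sp (g m) := fun I => by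
    rw [← FS5.map_sp, FS5.map_dvd]
  have hd2 : ∀ I : Ideal (𝓞 K), Ideal.span {(2 : 𝓞 K)} ∣ I ↔ FS5.sp 2 ∣ I.map g := fun I => by
    rw [← FS5.map_dvd g, FS5.map_sp, map_ofNat]
  have hd4 : ∀ I : Ideal (𝓞 K), Ideal.span {(4 : 𝓞 K)} ∣ I ↔ FS5.sp 4 ∣ I.map g := fun I => by
    rw [← FS5.map_dvd g, FS5.map_sp, map_ofNat]
  rw [FS5.card_transfer g, FS5.Ico.main_O hg, FS5.sg, FS5.us, FS5.us]
  congr 1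
  · congr 1
    · congr 1
      symm
      refine FS5.finsum_transfer g _ _ fun I => ?_
      simp only [Set.mem_ofPred_eq, ← hdm]
      exact ⟨fun h => h.2, fun h => ⟨hbot I h, h⟩⟩
    · congr 1
      symm
      refine FS5.finsum_transfer g _ _ fun I => ?_
      simp only [Set.mem_ofPred_eq, ← hdm, ← hd2]
      exact ⟨fun h => h.2, fun h => ⟨hbot I h.1, h⟩⟩
  · congr 1
    symm
    refine FS5.finsum_transfer g _ _ fun I => ?_
    simp only [Set.mem_ofPred_eq, ← hdm, ← hd4]
    exact ⟨fun h => h.2, fun h => ⟨hbot I h.1, h⟩⟩
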